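/- arXiv:1208.2635 — 2 statements merged into one kernel-verified Lean document; each statement's English description precedes it below -/
import Mathlib

section
/- Fix ε > 0 and c ≥ 1, assume Conditions I((2+ε)s⋆) and I(s⋆ + s̄) hold, take λ = ((1+ε)·(23 + 5c) + 1)/ε·log p, assume in addition λ ≥ (62 + 4c)·log p, and assume min_{j ∈ J⋆} |β⋆_j| ≥ 3σ·√(λ/n)/ν_{(2+ε)s⋆}. Let β̂_mean = Σ_J Π(J)·β̂_J be the posterior mean. Then with probability at least 1 − 4p^(−c) over the Gaussian noise z: ‖β̂_mean − β⋆‖_∞ ≤ σ·√(2(c+1)·log p/(n·ν_{s⋆}²)) + (2√10·σ/(√n·ν_{s⋆+s̄}))·[2√(s⋆)/p^c + 1/p^{s⋆}]. -/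
open MeasureTheory ProbabilityTheory Finset
open scoped Classical ENNReal

section

open scoped NNReal RealInnerProductSpace

lemma map_inner_pi_gaussianReal {κ ι : Type*} [Fintype κ] [Fintype ι] (v : ℝ≥0)
    (u : ι → EuclideanSpace ℝ κ) (hu : Orthonormal ℝ u) :
    (Measure.pi fun _ : κ => gaussianReal 0 v).map
      (fun z i => ⟪u i, WithLp.toLp 2 z⟫) = Measure.pi fun _ : ι => gaussianReal 0 v := by
  have hm : Measurable (fun (z : κ → ℝ) (i : ι) => ⟪u i, WithLp.toLp 2 z⟫) := by fun_prop
  have : IsProbabilityMeasure ((Measure.pi fun _ : κ => gaussianReal 0 v).map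
      (fun z i => ⟪u i, WithLp.toLp 2 z⟫)) := Measure.isProbabilityMeasure_map hm.aemeasurable
  rw [← charFun_eq_pi_iff]
  intro t
  have key : charFun ((Measure.pi fun _ : κ => gaussianReal 0 v).map (WithLp.toLp 2))
      (∑ i, t i • u i) = ∏ i, charFun (gaussianReal 0 v) (t i) := by
    have hn : ∑ k, ((∑ i, t i • u i : EuclideanSpace ℝ κ) k) ^ 2 = ∑ i, (t i) ^ 2 := by
      rw [← EuclideanSpace.real_norm_sq_eq, ← real_inner_self_eq_norm_sq, hu.inner_sum]
      simp [pow_two]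
    simp_rw [charFun_pi, charFun_gaussianReal, ← Complex.exp_sum]
    congr 1
    simp only [Complex.ofReal_zero, mul_zero, zero_mul, zero_sub]
    rw [Finset.sum_neg_distrib, Finset.sum_neg_distrib, ← Finset.sum_div, ← Finset.sum_div,
      ← Finset.mul_sum, ← Finset.mul_sum]
    congr 3
    exact_mod_cast hn
  rw [← key, charFun_apply, charFun_apply, integral_map (by fun_prop) (by fun_prop),
    integral_map (by fun_prop) (by fun_prop), integral_map (by fun_prop) (by fun_prop)]
  congr 1
  ext z
  congr 2
  simp only [inner_sum, inner_smul_right,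
    PiLp.inner_apply (𝕜 := ℝ) (x := WithLp.toLp 2 _) (y := t)]
  push_cast
  refine Finset.sum_congr rfl fun i _ => ?_
  simp [real_inner_comm]

lemma integrable_exp_sq_div_gaussianReal {v : ℝ≥0} (hv : v ≠ 0) :
    Integrable (fun x : ℝ => Real.exp (x ^ 2 / (4 * v))) (gaussianReal 0 v) ∧
      ∫ x, Real.exp (x ^ 2 / (4 * v)) ∂(gaussianReal 0 v) = Real.sqrt 2 := by
  have hv' : (0 : ℝ) < v := by positivity
  have hd : ∀ x : ℝ, gaussianPDFReal 0 v x * Real.exp (x ^ 2 / (4 * v))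
      = (Real.sqrt (2 * Real.pi * v))⁻¹ * Real.exp (-(1 / (4 * v)) * x ^ 2) := by
    intro x
    rw [gaussianPDFReal, mul_assoc, ← Real.exp_add]
    congr 2
    field_simp
    ring
  constructor
  · rw [gaussianReal_of_var_ne_zero _ hv,
      integrable_withDensity_iff_integrable_smul' (measurable_gaussianPDF 0 v)
        (Filter.Eventually.of_forall fun _ => gaussianPDF_lt_top)]
    simp_rw [toReal_gaussianPDF, smul_eq_mul, hd]
    exact (integrable_exp_neg_mul_sq (by positivity)).const_mul _
  · rw [integral_gaussianReal_eq_integral_smul hv]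
    simp_rw [smul_eq_mul, hd]
    rw [integral_const_mul, integral_gaussian, ← Real.sqrt_inv, ← Real.sqrt_mul (by positivity)]
    congr 1
    field_simp
    norm_num

lemma measureReal_lt_norm_starProjection_sq_le {κ : Type*} [Fintype κ] {v : ℝ≥0} (hv : v ≠ 0)
    (S : Submodule ℝ (EuclideanSpace ℝ κ)) (t : ℝ) :
    (Measure.pi fun _ : κ => gaussianReal 0 v).real
        {z | t * v < ‖S.starProjection (WithLp.toLp 2 z)‖ ^ 2}
      ≤ Real.sqrt 2 ^ Module.finrank ℝ S * Real.exp (-(t / 4)) := by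
  have hv' : (0 : ℝ) < v := by positivity
  set b := stdOrthonormalBasis ℝ S
  set u : Fin (Module.finrank ℝ S) → EuclideanSpace ℝ κ := fun i => b i
  have hu : Orthonormal ℝ u := b.orthonormal.comp_linearIsometry S.subtypeₗᵢ
  have hnorm : ∀ z, ‖S.starProjection z‖ ^ 2 = ∑ i, ⟪u i, z⟫ ^ 2 := by
    intro z
    rw [Submodule.starProjection_apply, ← Submodule.coe_norm, ← b.sum_sq_inner_right]
    refine Finset.sum_congr rfl fun i _ => ?_
    congr 1
    exact (Submodule.inner_orthogonalProjectionOnto_eq_of_mem_left (b i) z)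
  have hlaw := map_inner_pi_gaussianReal v u hu
  have hm : Measurable (fun (z : κ → ℝ) (i : Fin (Module.finrank ℝ S)) =>
    ⟪u i, WithLp.toLp 2 z⟫) := by fun_prop
  have hset : {z : κ → ℝ | t * v < ‖S.starProjection (WithLp.toLp 2 z)‖ ^ 2}
      = (fun z i => ⟪u i, WithLp.toLp 2 z⟫) ⁻¹' {x | t * v < ∑ i, x i ^ 2} := by
    ext z; simp [hnorm]
  have hms : MeasurableSet {x : Fin (Module.finrank ℝ S) → ℝ | t * v < ∑ i, x i ^ 2} :=
    measurableSet_lt (by fun_prop) (by fun_prop)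
  rw [hset, ← map_measureReal_apply hm hms, hlaw]
  have hintegrable := Integrable.fintype_prod (μ := fun _ : Fin (Module.finrank ℝ S) => gaussianReal 0 v)
    (fun _ => (integrable_exp_sq_div_gaussianReal hv).1)
  have hval := integral_fintype_prod_eq_prod
    (μ := fun _ : Fin (Module.finrank ℝ S) => gaussianReal 0 v)
    (f := fun _ x => Real.exp (x ^ 2 / (4 * v)))
  rw [(integrable_exp_sq_div_gaussianReal hv).2, Finset.prod_const, Finset.card_univ,
    Fintype.card_fin] at hval
  have hmk := mul_meas_ge_le_integral_of_nonneg (Filter.Eventually.of_forall fun x =>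
    Finset.prod_nonneg fun i _ => (Real.exp_pos _).le) hintegrable (Real.exp (t / 4))
  rw [hval] at hmk
  rw [Real.exp_neg, ← div_eq_mul_inv, le_div_iff₀ (Real.exp_pos _), mul_comm]
  refine le_trans (mul_le_mul_of_nonneg_left (measureReal_mono fun x hx => ?_)
    (Real.exp_pos _).le) hmk
  change Real.exp (t / 4) ≤ _
  change t * v < _ at hx
  rw [← Real.exp_sum, Real.exp_le_exp, ← Finset.sum_div, le_div_iff₀ (by positivity)]
  linarith

lemma measureReal_lt_abs_inner_le {κ : Type*} [Fintype κ] (v : ℝ≥0)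
    (u : EuclideanSpace ℝ κ) (hu : ‖u‖ = 1) {t : ℝ} (ht : 0 ≤ t) :
    (Measure.pi fun _ : κ => gaussianReal 0 v).real
        {z | t < |⟪u, WithLp.toLp 2 z⟫|} ≤ 2 * Real.exp (-t ^ 2 / (2 * v)) := by
  have hlaw := map_inner_pi_gaussianReal v (fun _ : Unit => u) ⟨fun _ => hu, fun i j h =>
    (h (Subsingleton.elim _ _)).elim⟩
  have hm : Measurable fun z : κ → ℝ => ⟪u, WithLp.toLp 2 z⟫ := by fun_prop
  have hlaw' : (Measure.pi fun _ : κ => gaussianReal 0 v).map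
      (fun z => ⟪u, WithLp.toLp 2 z⟫) = gaussianReal 0 v := by
    have := congrArg (fun m => m.map (fun x : Unit → ℝ => x ())) hlaw
    rw [Measure.map_map (by fun_prop) (by fun_prop)] at this
    rw [(measurePreserving_eval (fun _ : Unit => gaussianReal 0 v) ()).map_eq] at this
    exact this
  have hsg : HasSubgaussianMGF (fun z : κ → ℝ => ⟪u, WithLp.toLp 2 z⟫) v
      (Measure.pi fun _ : κ => gaussianReal 0 v) := by
    refine ⟨fun s => ?_, fun s => ?_⟩
    · have := integrable_exp_mul_gaussianReal (μ := 0) (v := v) s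
      rw [← hlaw'] at this
      exact this.comp_measurable hm
    · rw [mgf_gaussianReal hlaw']
      simp
  have h1 := hsg.measure_ge_le ht
  have h2 := hsg.neg.measure_ge_le ht
  calc _ ≤ (Measure.pi fun _ : κ => gaussianReal 0 v).real
        ({z | t ≤ ⟪u, WithLp.toLp 2 z⟫} ∪ {z | t ≤ -⟪u, WithLp.toLp 2 z⟫}) := by
        refine measureReal_mono fun z hz => ?_
        change t < _ at hz
        exact le_abs.1 hz.le
    _ ≤ _ := (measureReal_union_le _ _).trans (by
        simp only [Pi.neg_apply] at h2
        linarith)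

/-- The span of the columns indexed by `J`. -/
noncomputable abbrev colSpan {ι V : Type*} [NormedAddCommGroup V] [InnerProductSpace ℝ V]
    (x : ι → V) (J : Finset ι) : Submodule ℝ V :=
  Submodule.span ℝ (x '' J)

/-- A subspace carrying the noise that enters the comparison of the models `J` and `J₀`
when the signal is `f`. -/
noncomputable def noiseSpace {ι V : Type*} [DecidableEq ι] [NormedAddCommGroup V]
    [InnerProductSpace ℝ V] [FiniteDimensional ℝ V] (x : ι → V) (f : V) (J₀ J : Finset ι) :
    Submodule ℝ V :=
  Submodule.span ℝ (insert (f - (colSpan x J).starProjection f)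
    ((J \ J₀).image fun j => x j - (colSpan x (J ∩ J₀)).starProjection (x j)) : Finset V)

section

variable {ι V : Type*} [DecidableEq ι] [NormedAddCommGroup V] [InnerProductSpace ℝ V]
  [FiniteDimensional ℝ V] (x : ι → V) (f z : V) (J₀ J : Finset ι)

omit [DecidableEq ι] [FiniteDimensional ℝ V] in
lemma colSpan_mono {I J : Finset ι} (h : I ⊆ J) : colSpan x I ≤ colSpan x J :=
  Submodule.span_mono (Set.image_mono (by exact_mod_cast h))

lemma finrank_noiseSpace_le : Module.finrank ℝ (noiseSpace x f J₀ J) ≤ #(J \ J₀) + 1 := by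
  refine (finrank_span_finset_le_card _).trans ((Finset.card_insert_le _ _).trans ?_)
  gcongr
  exact Finset.card_image_le

lemma residual_mem_noiseSpace :
    f - (colSpan x J).starProjection f ∈ noiseSpace x f J₀ J :=
  Submodule.subset_span (by simp)

lemma starProjection_sub_mem_noiseSpace :
    (colSpan x J).starProjection z - (colSpan x (J ∩ J₀)).starProjection z
      ∈ noiseSpace x f J₀ J := by
  have hle : colSpan x (J ∩ J₀) ≤ colSpan x J := colSpan_mono x Finset.inter_subset_left
  have h : ∀ w ∈ colSpan x J,
      w - (colSpan x (J ∩ J₀)).starProjection w ∈ noiseSpace x f J₀ J := by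
    intro w hw
    induction hw using Submodule.span_induction with
    | mem w hw =>
      obtain ⟨j, hj, rfl⟩ := hw
      by_cases hj0 : j ∈ J₀
      · have : x j ∈ colSpan x (J ∩ J₀) := Submodule.subset_span ⟨j, by simp_all, rfl⟩
        rw [Submodule.starProjection_eq_self_iff.2 this, sub_self]
        exact zero_mem _
      · refine Submodule.subset_span ?_
        simp only [coe_insert, coe_image, Set.mem_insert_iff]
        exact Or.inr ⟨j, by simp_all, rfl⟩
    | zero => simp
    | add a b _ _ ha hb => rw [map_add, add_sub_add_comm]; exact add_mem ha hb
    | smul c a _ ha => rw [map_smul, ← smul_sub]; exact Submodule.smul_mem _ _ ha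
  have h2 := h _ (Submodule.starProjection_apply_mem (colSpan x J) z)
  rwa [← ContinuousLinearMap.comp_apply,
    Submodule.starProjection_comp_starProjection_of_le hle] at h2

omit [FiniteDimensional ℝ V] in
lemma exists_inner_eq_norm_mul_of_mem (S : Submodule ℝ V) [S.HasOrthogonalProjection] {r h z : V}
    (hr : r ∈ S) (hh : h ∈ S) (hrh : ⟪r, h⟫ = 0) (hz : ⟪h, z⟫ = ‖h‖ ^ 2) :
    ∃ g, ⟪r, z⟫ = ‖r‖ * g ∧ g ^ 2 + ‖h‖ ^ 2 ≤ ‖S.starProjection z‖ ^ 2 := by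
  rcases eq_or_ne r 0 with rfl | hr0
  · refine ⟨0, by simp, ?_⟩
    have h1 : ⟪h, S.starProjection z⟫ = ‖h‖ ^ 2 := by
      rw [← hz, ← Submodule.inner_starProjection_left_eq_right,
        Submodule.starProjection_eq_self_iff.2 hh]
    have := norm_sub_sq_real h (S.starProjection z)
    nlinarith [sq_nonneg ‖h - S.starProjection z‖]
  · have hn : ‖r‖ ≠ 0 := norm_ne_zero_iff.2 hr0
    refine ⟨⟪r, z⟫ / ‖r‖, by field_simp, ?_⟩
    set g := ⟪r, z⟫ / ‖r‖ with hg
    set k := h + (g / ‖r‖) • r with hk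
    have hkS : k ∈ S := add_mem hh (S.smul_mem _ hr)
    have h1 : ⟪k, S.starProjection z⟫ = ‖h‖ ^ 2 + g ^ 2 := by
      rw [← Submodule.inner_starProjection_left_eq_right,
        Submodule.starProjection_eq_self_iff.2 hkS, hk, inner_add_left, hz,
        real_inner_smul_left, hg]
      field_simp
    have h2 : ‖k‖ ^ 2 = ‖h‖ ^ 2 + g ^ 2 := by
      rw [hk, norm_add_sq_real, real_inner_smul_right, real_inner_comm, hrh, norm_smul, mul_pow]
      simp
      field_simp
      exact sq_abs g
    have := norm_sub_sq_real k (S.starProjection z)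
    nlinarith [sq_nonneg ‖k - S.starProjection z‖]

omit [FiniteDimensional ℝ V] in
lemma norm_starProjection_sub_sq {K L : Submodule ℝ V} [K.HasOrthogonalProjection]
    [L.HasOrthogonalProjection] (h : K ≤ L) :
    ‖L.starProjection z - K.starProjection z‖ ^ 2
        = ‖L.starProjection z‖ ^ 2 - ‖K.starProjection z‖ ^ 2 ∧
      ⟪L.starProjection z - K.starProjection z, z⟫
        = ‖L.starProjection z - K.starProjection z‖ ^ 2 := by
  have hL : ⟪L.starProjection z, z⟫ = ‖L.starProjection z‖ ^ 2 := by
    rw [← real_inner_self_eq_norm_sq, ← Submodule.inner_starProjection_left_eq_right,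
      Submodule.starProjection_eq_self_iff.2 (Submodule.starProjection_apply_mem L z)]
  have hK : ⟪K.starProjection z, z⟫ = ‖K.starProjection z‖ ^ 2 := by
    rw [← real_inner_self_eq_norm_sq, ← Submodule.inner_starProjection_left_eq_right,
      Submodule.starProjection_eq_self_iff.2 (Submodule.starProjection_apply_mem K z)]
  have hKL : ⟪L.starProjection z, K.starProjection z⟫ = ‖K.starProjection z‖ ^ 2 := by
    rw [Submodule.inner_starProjection_left_eq_right, Submodule.starProjection_eq_self_iff.2
      (h (Submodule.starProjection_apply_mem K z)), real_inner_comm, hK]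
  have := norm_sub_sq_real (L.starProjection z) (K.starProjection z)
  rw [inner_sub_left]
  constructor <;> linarith

omit [FiniteDimensional ℝ V] in
lemma norm_sub_starProjection_add_sq (K : Submodule ℝ V) [K.HasOrthogonalProjection] :
    ‖f + z - K.starProjection (f + z)‖ ^ 2
      = ‖f - K.starProjection f‖ ^ 2 + 2 * ⟪f - K.starProjection f, z⟫
        + (‖z‖ ^ 2 - ‖K.starProjection z‖ ^ 2) := by
  have h1 : f + z - K.starProjection (f + z)
      = (f - K.starProjection f) + (z - K.starProjection z) := by
    rw [map_add]; abel
  have h2 : ⟪f - K.starProjection f, K.starProjection z⟫ = 0 :=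
    Submodule.starProjection_inner_eq_zero _ _ (Submodule.starProjection_apply_mem K z)
  have h3 : ⟪z - K.starProjection z, K.starProjection z⟫ = 0 :=
    Submodule.starProjection_inner_eq_zero _ _ (Submodule.starProjection_apply_mem K z)
  have h4 := norm_add_sq_real (z - K.starProjection z) (K.starProjection z)
  rw [sub_add_cancel, h3] at h4
  rw [h1, norm_add_sq_real, inner_sub_right, h2]
  linarith

/-- Comparison of the residual sums of squares and of the fitted values of the models `J` and `J₀`,
when the signal lies in the span of `J₀`. -/
lemma exists_model_comparison (hf : f ∈ colSpan x J₀) :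
    ∃ e b g : ℝ, 0 ≤ e ∧ 0 ≤ b ∧
      ‖f + z - (colSpan x J).starProjection (f + z)‖ ^ 2
          - ‖f + z - (colSpan x J₀).starProjection (f + z)‖ ^ 2
        = ‖f - (colSpan x J).starProjection f‖ ^ 2
          + 2 * ‖f - (colSpan x J).starProjection f‖ * g - e ^ 2 + b ^ 2 ∧
      ‖(colSpan x J).starProjection (f + z) - (colSpan x J₀).starProjection (f + z)‖
        ≤ ‖f - (colSpan x J).starProjection f‖ + e + b ∧
      g ^ 2 + e ^ 2 ≤ ‖(noiseSpace x f J₀ J).starProjection z‖ ^ 2 := by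
  have hJ : colSpan x (J ∩ J₀) ≤ colSpan x J := colSpan_mono x Finset.inter_subset_left
  have hJ₀ : colSpan x (J ∩ J₀) ≤ colSpan x J₀ := colSpan_mono x Finset.inter_subset_right
  obtain ⟨hJ1, hJ2⟩ := norm_starProjection_sub_sq z hJ
  obtain ⟨hJ₀1, -⟩ := norm_starProjection_sub_sq z hJ₀
  obtain ⟨g, hg, hge⟩ := exists_inner_eq_norm_mul_of_mem (noiseSpace x f J₀ J)
    (residual_mem_noiseSpace x f J₀ J) (starProjection_sub_mem_noiseSpace x f z J₀ J)
    (Submodule.starProjection_inner_eq_zero _ _ (sub_mem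
      (Submodule.starProjection_apply_mem _ z) (hJ (Submodule.starProjection_apply_mem _ z)))) hJ2
  have hf0 := Submodule.starProjection_eq_self_iff.2 hf
  refine ⟨_, ‖(colSpan x J₀).starProjection z - (colSpan x (J ∩ J₀)).starProjection z‖, g,
    norm_nonneg _, norm_nonneg _, ?_, ?_, hge⟩
  · rw [norm_sub_starProjection_add_sq, norm_sub_starProjection_add_sq, hg, hJ1, hJ₀1, hf0]
    simp
    ring
  · have : (colSpan x J).starProjection (f + z) - (colSpan x J₀).starProjection (f + z)
        = (((colSpan x J).starProjection z - (colSpan x (J ∩ J₀)).starProjection z)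
          - (f - (colSpan x J).starProjection f))
          - ((colSpan x J₀).starProjection z - (colSpan x (J ∩ J₀)).starProjection z) := by
      rw [map_add, map_add, hf0]; abel
    rw [this]
    refine (norm_sub_le _ _).trans (add_le_add ((norm_sub_le _ _).trans ?_) le_rfl)
    rw [add_comm]

end

lemma choose_succ_le_mul_choose (p a : ℕ) : p.choose (a + 1) ≤ p * p.choose a := by
  have h := Nat.choose_succ_right_eq p a
  calc p.choose (a + 1) ≤ p.choose (a + 1) * (a + 1) := Nat.le_mul_of_pos_right _ (by omega)
    _ = p.choose a * (p - a) := h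
    _ ≤ p.choose a * p := by gcongr; omega
    _ = _ := mul_comm _ _

lemma choose_le_mul_choose_succ {p a : ℕ} (h : a + 1 ≤ p) :
    p.choose a ≤ p * p.choose (a + 1) := by
  have h1 := Nat.choose_succ_right_eq p a
  calc p.choose a ≤ p.choose a * (p - a) := Nat.le_mul_of_pos_right _ (by omega)
    _ = p.choose (a + 1) * (a + 1) := h1.symm
    _ ≤ p.choose (a + 1) * p := by gcongr
    _ = _ := mul_comm _ _

lemma choose_add_le_pow_mul_choose (p a k : ℕ) : p.choose (a + k) ≤ p ^ k * p.choose a := by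
  induction k with
  | zero => simp
  | succ k ih =>
    calc p.choose (a + (k + 1)) ≤ p * p.choose (a + k) := choose_succ_le_mul_choose p (a + k)
      _ ≤ p * (p ^ k * p.choose a) := by gcongr
      _ = _ := by ring

lemma choose_le_pow_mul_choose_add (p a k : ℕ) (h : a + k ≤ p) :
    p.choose a ≤ p ^ k * p.choose (a + k) := by
  induction k with
  | zero => simp
  | succ k ih =>
    calc p.choose a ≤ p ^ k * p.choose (a + k) := ih (by omega)
      _ ≤ p ^ k * (p * p.choose (a + k + 1)) := by
        gcongr
        exact choose_le_mul_choose_succ h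
      _ = _ := by rw [add_assoc]; ring

lemma choose_le_pow_mul_choose {p a b d : ℕ} (hp : 1 ≤ p) (hb : b ≤ p) (hab : a ≤ b + d)
    (hba : b ≤ a + d) : p.choose a ≤ p ^ d * p.choose b := by
  rcases le_total a b with h | h
  · obtain ⟨k, rfl⟩ := Nat.exists_eq_add_of_le h
    refine (choose_le_pow_mul_choose_add p a k hb).trans ?_
    gcongr; omega
  · obtain ⟨k, rfl⟩ := Nat.exists_eq_add_of_le h
    refine (choose_add_le_pow_mul_choose p b k).trans ?_
    gcongr; omega

lemma sum_pow_card_symmDiff {ι R : Type*} [Fintype ι] [DecidableEq ι] [CommSemiring R]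
    (J₀ : Finset ι) (q : R) :
    ∑ J : Finset ι, q ^ #(symmDiff J J₀) = (1 + q) ^ Fintype.card ι := by
  have h1 : ∑ J : Finset ι, q ^ #(symmDiff J J₀) = ∑ D : Finset ι, q ^ #D :=
    Finset.sum_nbij' (fun J => symmDiff J J₀) (fun D => symmDiff D J₀) (by simp) (by simp)
      (by simp) (by simp) (by simp)
  have h2 := Finset.sum_pow_mul_eq_add_pow q 1 (Finset.univ : Finset ι)
  rw [h1, add_comm, ← Finset.card_univ, ← h2, Finset.powerset_univ]
  simp

lemma sum_exp_card_symmDiff_le {p : ℕ} (hp : 2 ≤ p) (J₀ : Finset (Fin p)) :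
    ∑ J : Finset (Fin p), Real.exp (-(2 * #(symmDiff J J₀) * Real.log p)) ≤ 33 / 20 := by
  have hp' : (2 : ℝ) ≤ p := by exact_mod_cast hp
  have h1 : ∀ J : Finset (Fin p), Real.exp (-(2 * #(symmDiff J J₀) * Real.log p))
      = (((p : ℝ) ^ 2)⁻¹) ^ #(symmDiff J J₀) := by
    intro J
    rw [← Real.exp_log (by positivity : 0 < (((p : ℝ) ^ 2)⁻¹) ^ #(symmDiff J J₀))]
    simp only [Real.log_pow, Real.log_inv]
    congr 1
    push_cast
    ring
  simp_rw [h1]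
  rw [sum_pow_card_symmDiff, Fintype.card_fin]
  have h2 : (1 + ((p : ℝ) ^ 2)⁻¹) ^ p ≤ Real.exp (1 / 2) := by
    calc (1 + ((p : ℝ) ^ 2)⁻¹) ^ p ≤ Real.exp (((p : ℝ) ^ 2)⁻¹) ^ p := by
          gcongr
          rw [add_comm]
          exact Real.add_one_le_exp _
      _ = Real.exp (p * ((p : ℝ) ^ 2)⁻¹) := by rw [← Real.exp_nat_mul]
      _ ≤ Real.exp (1 / 2) := by
          gcongr
          rw [← div_eq_mul_inv, div_le_div_iff₀ (by positivity) (by norm_num)]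
          nlinarith
  refine h2.trans ?_
  have h3 : Real.exp (1 / 2) ^ 2 = Real.exp 1 := by rw [← Real.exp_nat_mul]; norm_num
  have h4 := Real.exp_one_lt_d9
  nlinarith [Real.exp_pos (1 / 2)]

lemma le_mul_exp_mul_sq {t s : ℝ} (hs : 0 < s) : t ≤ s * Real.exp (t ^ 2 / (4 * s ^ 2)) := by
  have h := Real.add_one_le_exp (t ^ 2 / (4 * s ^ 2))
  have h2 : t ≤ s * (t ^ 2 / (4 * s ^ 2) + 1) := by
    have : s * (t ^ 2 / (4 * s ^ 2) + 1) - t = (t - 2 * s) ^ 2 / (4 * s) := by field_simp; ring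
    have : 0 ≤ (t - 2 * s) ^ 2 / (4 * s) := by positivity
    linarith
  nlinarith

lemma add_le_seven_mul_exp {a e b : ℝ} :
    a + e + b ≤ 7 * Real.exp (a ^ 2 / 48 + e ^ 2 / 16 + b ^ 2 / 2) := by
  have ha : a ≤ 4 * Real.exp (a ^ 2 / 48 + e ^ 2 / 16 + b ^ 2 / 2) := by
    refine (le_mul_exp_mul_sq (by norm_num : (0 : ℝ) < 4)).trans ?_
    gcongr
    nlinarith [sq_nonneg a, sq_nonneg b, sq_nonneg e]
  have he : e ≤ 2 * Real.exp (a ^ 2 / 48 + e ^ 2 / 16 + b ^ 2 / 2) := by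
    refine (le_mul_exp_mul_sq (by norm_num : (0 : ℝ) < 2)).trans ?_
    gcongr
    nlinarith [sq_nonneg a, sq_nonneg b, sq_nonneg e]
  have hb : b ≤ 1 * Real.exp (a ^ 2 / 48 + e ^ 2 / 16 + b ^ 2 / 2) := by
    refine (le_mul_exp_mul_sq (by norm_num : (0 : ℝ) < 1)).trans ?_
    gcongr
    nlinarith [sq_nonneg a, sq_nonneg b, sq_nonneg e]
  linarith

lemma exponent_le {c ε L lam s m k a e g : ℝ} (hc : 1 ≤ c) (hε : 0 < ε) (hL : 0 ≤ L)
    (hlam : lam = (((1 + ε) * (23 + 5 * c) + 1) / ε) * L) (hlam2 : (62 + 4 * c) * L ≤ lam)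
    (hm : 0 ≤ m) (hk : 0 ≤ k) (hks : k ≤ s) (hmk : 1 ≤ m + k) (hk1 : k = 0 ∨ 1 ≤ k)
    (ha : k = 0 → a = 0) (hbig : s + m ≤ (2 + ε) * s → 9 * k * lam ≤ a ^ 2)
    (hge : g ^ 2 + e ^ 2 ≤ 4 * (c + 3 * (m + k)) * L) :
    (m + k) * L - lam * (m - k) - (a ^ 2 + 2 * a * g - e ^ 2) / 2 + a ^ 2 / 48 + e ^ 2 / 16
      ≤ max (-(c * L)) (-(s * L)) - 3 * (m + k) * L := by
  rcases le_or_gt (s + m) ((2 + ε) * s) with h | h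
  · refine le_trans ?_ (sub_le_sub_right (le_max_left _ _) _)
    rcases hk1 with rfl | hk1
    · rw [ha rfl]
      have h1 : 1 ≤ m := by linarith
      have h2 := mul_le_mul_of_nonneg_right hlam2 hm
      have h3 : L * 1 ≤ L * m := by gcongr
      have h4 : c * (L * 1) ≤ c * (L * m) := by gcongr
      nlinarith [sq_nonneg g]
    · have hb := hbig h
      have h0 : -(a * g) ≤ a ^ 2 / 6 + 3 / 2 * g ^ 2 := by nlinarith [sq_nonneg (a + 3 * g)]
      have h2 := mul_le_mul_of_nonneg_right hlam2 hm
      have h2' := mul_le_mul_of_nonneg_right hlam2 hk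
      have h3 : L * 1 ≤ L * k := by gcongr
      have h4 : c * (L * 1) ≤ c * (L * k) := by gcongr
      have h5 : 0 ≤ L * m := by positivity
      have h6 : 0 ≤ c * (L * m) := by positivity
      nlinarith [sq_nonneg e]
  · refine le_trans ?_ (sub_le_sub_right (le_max_right _ _) _)
    have h0 : -(a * g) ≤ 23 / 48 * a ^ 2 + 9 / 16 * g ^ 2 := by
      nlinarith [sq_nonneg (a + 24 / 23 * g), sq_nonneg g]
    have hs : 0 ≤ s := hk.trans hks
    have hms : (1 + ε) * s ≤ m := by linarith
    have hmk' : k ≤ m := by nlinarith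
    have hm1 : 1 / 2 ≤ m := by linarith
    have hl : m * (23 + 5 * c) * L + s * L ≤ lam * (m - k) := by
      have e1 : lam * ε = ((1 + ε) * (23 + 5 * c) + 1) * L := by rw [hlam]; field_simp
      have e2 : m * ε ≤ (m - k) * (1 + ε) := by nlinarith
      have hlam0 : 0 ≤ lam := le_trans (by positivity) hlam2
      have e3 := mul_le_mul_of_nonneg_left e2 hlam0
      have e4 : lam * (m * ε) = m * (1 + ε) * (23 + 5 * c) * L + m * L := by
        rw [mul_left_comm, e1]; ring
      have e5 : (1 + ε) * s * L ≤ m * L := by gcongr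
      have e6 : (m * (23 + 5 * c) * L + s * L) * (1 + ε) ≤ lam * (m - k) * (1 + ε) := by nlinarith
      exact le_of_mul_le_mul_right e6 (by linarith)
    have h3 : L * k ≤ L * m := by gcongr
    have h4 : c * L * (1 / 2) ≤ c * L * m := by gcongr
    nlinarith [sq_nonneg e]

section

variable {ι V : Type*} [Fintype ι] [DecidableEq ι] [NormedAddCommGroup V] [InnerProductSpace ℝ V]
  [FiniteDimensional ℝ V] {x : ι → V} {J₀ J : Finset ι}

omit [DecidableEq ι] [FiniteDimensional ℝ V] in
lemma mem_colSpan_iff {v : V} :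
    v ∈ colSpan x J ↔ ∃ u : ι → ℝ, (∀ j ∉ J, u j = 0) ∧ ∑ j, u j • x j = v := by
  rw [Submodule.mem_span_image_finset_iff_exists_fun']
  constructor
  · rintro ⟨c, rfl⟩
    refine ⟨fun j => if j ∈ J then c j else 0, fun j hj => if_neg hj, ?_⟩
    simp [ite_smul, Finset.sum_ite_mem]
  · rintro ⟨u, hu, rfl⟩
    exact ⟨u, Finset.sum_subset (Finset.subset_univ _) fun j _ hj => by rw [hu j hj, zero_smul]⟩

lemma card_mul_le_norm_residual_sq {κ B : ℝ} {β : ι → ℝ} (hβ : ∀ j ∉ J₀, β j = 0)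
    (hlow : ∀ u : ι → ℝ, (∀ j ∉ J₀ ∪ J, u j = 0) →
      κ ^ 2 * ∑ j, u j ^ 2 ≤ ‖∑ j, u j • x j‖ ^ 2)
    (hB : ∀ j ∈ J₀, B ≤ κ ^ 2 * β j ^ 2) :
    #(J₀ \ J) * B
      ≤ ‖∑ j, β j • x j - (colSpan x J).starProjection (∑ j, β j • x j)‖ ^ 2 := by
  obtain ⟨w, hw, hwx⟩ := mem_colSpan_iff.1
    (Submodule.starProjection_apply_mem (colSpan x J) (∑ j, β j • x j))
  rw [← hwx, ← Finset.sum_sub_distrib]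
  simp_rw [← sub_smul]
  refine le_trans ?_ (hlow _ fun j hj => ?_)
  · calc #(J₀ \ J) * B = ∑ j ∈ J₀ \ J, B := by simp
      _ ≤ ∑ j ∈ J₀ \ J, κ ^ 2 * (β j - w j) ^ 2 := by
        refine Finset.sum_le_sum fun j hj => ?_
        rw [Finset.mem_sdiff] at hj
        rw [hw j hj.2, sub_zero]
        exact hB j hj.1
      _ ≤ ∑ j, κ ^ 2 * (β j - w j) ^ 2 :=
        Finset.sum_le_sum_of_subset_of_nonneg (Finset.subset_univ _) fun _ _ _ => by positivity
      _ = _ := by rw [Finset.mul_sum]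
  · rw [Finset.mem_union, not_or] at hj
    rw [hβ j hj.1, hw j hj.2, sub_zero]

/-- A coordinate of the least-squares noise is controlled by the inner product of the noise with the
residual of the corresponding column on the remaining ones. -/
lemma abs_coord_mul_le_of_abs_inner_le {κ T : ℝ} (hκ : 0 < κ)
    (hlow : ∀ u : ι → ℝ, (∀ j ∉ J, u j = 0) → κ ^ 2 * ∑ j, u j ^ 2 ≤ ‖∑ j, u j • x j‖ ^ 2)
    {u : ι → ℝ} {z : V} (hu : ∀ j ∉ J, u j = 0)
    (huz : ∑ j, u j • x j = (colSpan x J).starProjection z) {j : ι} (hj : j ∈ J)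
    (hT : |⟪x j - (colSpan x (J.erase j)).starProjection (x j), z⟫|
      ≤ ‖x j - (colSpan x (J.erase j)).starProjection (x j)‖ * T) :
    |u j| * κ ≤ T := by
  obtain ⟨w, hw, hwx⟩ := mem_colSpan_iff.1
    (Submodule.starProjection_apply_mem (colSpan x (J.erase j)) (x j))
  set r := x j - (colSpan x (J.erase j)).starProjection (x j) with hr
  have horth : ∀ v ∈ colSpan x (J.erase j), ⟪r, v⟫ = 0 := fun v hv =>
    Submodule.starProjection_inner_eq_zero _ _ hv
  have hrsum : r = ∑ i, (Pi.single j 1 - w : ι → ℝ) i • x i := by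
    simp [hr, ← hwx, sub_smul, Pi.single_apply, ite_smul]
  have hwj : w j = 0 := hw j (Finset.notMem_erase _ _)
  have hκr : κ ≤ ‖r‖ := by
    have h1 := hlow (Pi.single j 1 - w : ι → ℝ) fun i hi => by
      have hij : i ≠ j := fun h => hi (h ▸ hj)
      simp [hij, hw i fun h => hi (Finset.mem_of_mem_erase h)]
    have h2 : (1 : ℝ) ≤ ∑ i, (Pi.single j 1 - w : ι → ℝ) i ^ 2 := by
      refine le_trans ?_ (Finset.single_le_sum (fun i _ => sq_nonneg _) (Finset.mem_univ j))
      simp [hwj]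
    rw [← hrsum] at h1
    refine le_of_sq_le_sq ?_ (norm_nonneg _)
    nlinarith [sq_nonneg κ]
  have hrJ : r ∈ colSpan x J := sub_mem (Submodule.subset_span ⟨j, hj, rfl⟩)
    (colSpan_mono x (Finset.erase_subset _ _) (Submodule.starProjection_apply_mem _ _))
  have hrx : ⟪r, x j⟫ = ‖r‖ ^ 2 := by
    have : x j = r + (colSpan x (J.erase j)).starProjection (x j) := by rw [hr]; abel
    rw [this, inner_add_right, horth _ (Submodule.starProjection_apply_mem _ _), add_zero,
      real_inner_self_eq_norm_sq]
  have hrz : ⟪r, z⟫ = u j * ‖r‖ ^ 2 := by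
    rw [← Submodule.starProjection_eq_self_iff.2 hrJ,
      Submodule.inner_starProjection_left_eq_right, ← huz, inner_sum,
      Submodule.starProjection_eq_self_iff.2 hrJ, Finset.sum_eq_single j]
    · rw [real_inner_smul_right, hrx]
    · intro i _ hij
      by_cases hi : i ∈ J
      · rw [real_inner_smul_right, horth, mul_zero]
        exact Submodule.subset_span ⟨i, by simp [hi, hij], rfl⟩
      · rw [hu i hi, zero_smul, inner_zero_right]
    · simp
  rw [hrz, abs_mul, abs_of_nonneg (sq_nonneg ‖r‖)] at hT
  have hr0 : 0 < ‖r‖ := hκ.trans_le hκr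
  have : |u j| * ‖r‖ ≤ T := by
    refine le_of_mul_le_mul_left ?_ hr0
    linarith
  exact (mul_le_mul_of_nonneg_left hκr (abs_nonneg _)).trans this

end

/-- The unnormalised posterior weight of a model with `k` of the `p` columns and residual sum of
squares `R`. -/
noncomputable def modelWeight (p : ℕ) (lam σ : ℝ) (k : ℕ) (R : ℝ) : ℝ :=
  (p.choose k : ℝ)⁻¹ * Real.exp (-(lam * k)) * Real.exp (-R / (2 * σ ^ 2))

lemma modelWeight_mul_le {p : ℕ} (hp : 1 ≤ p) {lam σ R R' D B : ℝ} {k k' d : ℕ} (hk : k ≤ p)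
    (hk' : k' ≤ p) (h1 : k ≤ k' + d) (h2 : k' ≤ k + d)
    (h : Real.exp (d * Real.log p - lam * (k' - k) - (R' - R) / (2 * σ ^ 2)) * D ≤ B)
    (hD : 0 ≤ D) :
    modelWeight p lam σ k' R' * D ≤ modelWeight p lam σ k R * B := by
  have hc0 : (0 : ℝ) < p.choose k := by exact_mod_cast Nat.choose_pos hk
  have hc0' : (0 : ℝ) < p.choose k' := by exact_mod_cast Nat.choose_pos hk'
  have hp0 : (0 : ℝ) < p := by exact_mod_cast hp
  have hch : (p.choose k' : ℝ)⁻¹ ≤ (p.choose k : ℝ)⁻¹ * Real.exp (d * Real.log p) := by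
    rw [Real.exp_nat_mul, Real.exp_log hp0, ← div_eq_inv_mul, le_div_iff₀ hc0,
      ← div_eq_inv_mul, div_le_iff₀ hc0']
    exact_mod_cast choose_le_pow_mul_choose hp hk' h1 h2
  refine le_trans ?_ (mul_le_mul_of_nonneg_left h (by unfold modelWeight; positivity))
  unfold modelWeight
  rw [← mul_assoc]
  refine mul_le_mul_of_nonneg_right ?_ hD
  calc (p.choose k' : ℝ)⁻¹ * Real.exp (-(lam * k')) * Real.exp (-R' / (2 * σ ^ 2))
      ≤ (p.choose k : ℝ)⁻¹ * Real.exp (d * Real.log p) * Real.exp (-(lam * k'))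
          * Real.exp (-R' / (2 * σ ^ 2)) := by gcongr
    _ = _ := by
      simp only [mul_assoc, ← Real.exp_add]
      congr 2
      ring

lemma modelWeight_mul_norm_sub_le {p : ℕ} (hp : 1 ≤ p) {V : Type*} [NormedAddCommGroup V]
    [InnerProductSpace ℝ V] [FiniteDimensional ℝ V] {x : Fin p → V} {f z : V}
    {J₀ J : Finset (Fin p)} (hf : f ∈ colSpan x J₀) {c ε lam σ : ℝ} (hc : 1 ≤ c) (hε : 0 < ε)
    (hσ : 0 < σ) (hlam : lam = (((1 + ε) * (23 + 5 * c) + 1) / ε) * Real.log p)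
    (hlam2 : (62 + 4 * c) * Real.log p ≤ lam) (hne : J ≠ J₀)
    (hbig : (#(J₀ ∪ J) : ℝ) ≤ (2 + ε) * #J₀ →
      #(J₀ \ J) * (9 * σ ^ 2 * lam) ≤ ‖f - (colSpan x J).starProjection f‖ ^ 2)
    (hz : ‖(noiseSpace x f J₀ J).starProjection z‖ ^ 2
      ≤ 4 * (c + 3 * #(symmDiff J J₀)) * Real.log p * σ ^ 2) :
    modelWeight p lam σ #J (‖f + z - (colSpan x J).starProjection (f + z)‖ ^ 2)
      * ‖(colSpan x J).starProjection (f + z) - (colSpan x J₀).starProjection (f + z)‖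
    ≤ modelWeight p lam σ #J₀ (‖f + z - (colSpan x J₀).starProjection (f + z)‖ ^ 2)
      * (7 * σ * (Real.exp (-(c * Real.log p)) + Real.exp (-(#J₀ * Real.log p)))
        * Real.exp (-(3 * #(symmDiff J J₀) * Real.log p))) := by
  have hd : (#(symmDiff J J₀) : ℝ) = #(J \ J₀) + #(J₀ \ J) := by
    rw [symmDiff, Finset.sup_eq_union, Finset.card_union_of_disjoint disjoint_sdiff_sdiff]
    push_cast
    rfl
  have hJ : (#J : ℝ) = #(J ∩ J₀) + #(J \ J₀) := by
    exact_mod_cast (Finset.card_inter_add_card_sdiff J J₀).symm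
  have hJ₀ : (#J₀ : ℝ) = #(J ∩ J₀) + #(J₀ \ J) := by
    rw [Finset.inter_comm]
    exact_mod_cast (Finset.card_inter_add_card_sdiff J₀ J).symm
  have hunion : (#(J₀ ∪ J) : ℝ) = #J₀ + #(J \ J₀) := by
    rw [← Finset.union_sdiff_self_eq_union, Finset.card_union_of_disjoint Finset.disjoint_sdiff]
    push_cast
    rfl
  have hL : 0 ≤ Real.log p := Real.log_nonneg (by exact_mod_cast hp)
  obtain ⟨e, b, g, -, -, hR, hD, hge⟩ := exists_model_comparison x f z J₀ J hf
  set a := ‖f - (colSpan x J).starProjection f‖ with ha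
  have hne' : (1 : ℝ) ≤ #(J \ J₀) + #(J₀ \ J) := by
    rw [← hd]
    exact_mod_cast Finset.card_pos.2 (Finset.symmDiff_nonempty.2 hne)
  have hexp := exponent_le (s := #J₀) (m := #(J \ J₀)) (k := #(J₀ \ J)) (a := a / σ) (e := e / σ)
    (g := g / σ) hc hε hL hlam hlam2 (Nat.cast_nonneg _) (Nat.cast_nonneg _)
    (by exact_mod_cast Finset.card_le_card Finset.sdiff_subset) hne'
    (by rcases Nat.eq_zero_or_pos #(J₀ \ J) with h | h
        · exact Or.inl (by exact_mod_cast h)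
        · exact Or.inr (by exact_mod_cast h))
    (fun h => by
      have h' : J₀ ⊆ J := by
        rw [← Finset.sdiff_eq_empty_iff_subset, ← Finset.card_eq_zero]
        exact_mod_cast h
      rw [ha, Submodule.starProjection_eq_self_iff.2 (colSpan_mono x h' hf), sub_self, norm_zero,
        zero_div])
    (fun h => by
      have := hbig (by rwa [hunion])
      rw [div_pow, le_div_iff₀ (by positivity)]
      linarith)
    (by
      rw [div_pow, div_pow, ← add_div, div_le_iff₀ (by positivity), ← hd]
      exact hge.trans hz)
  refine modelWeight_mul_le (d := #(symmDiff J J₀)) hp ?_ ?_ ?_ ?_ ?_ (norm_nonneg _)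
  · simpa using Finset.card_le_univ J₀
  · simpa using Finset.card_le_univ J
  · have : (#J₀ : ℝ) ≤ #J + #(symmDiff J J₀) := by
      rw [hd, hJ, hJ₀]
      linarith [(Nat.cast_nonneg #(J \ J₀) : (0 : ℝ) ≤ _)]
    exact_mod_cast this
  · have : (#J : ℝ) ≤ #J₀ + #(symmDiff J J₀) := by
      rw [hd, hJ, hJ₀]
      linarith [(Nat.cast_nonneg #(J₀ \ J) : (0 : ℝ) ≤ _)]
    exact_mod_cast this
  have hD' : ‖(colSpan x J).starProjection (f + z) - (colSpan x J₀).starProjection (f + z)‖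
      ≤ σ * (7 * Real.exp ((a / σ) ^ 2 / 48 + (e / σ) ^ 2 / 16 + (b / σ) ^ 2 / 2)) := by
    refine (hD.trans (le_of_eq ?_)).trans
      (mul_le_mul_of_nonneg_left
        (add_le_seven_mul_exp (a := a / σ) (e := e / σ) (b := b / σ)) hσ.le)
    field_simp
  refine (mul_le_mul_of_nonneg_left hD' (Real.exp_nonneg _)).trans ?_
  rw [mul_left_comm, mul_left_comm _ (7 : ℝ), ← Real.exp_add, ← mul_assoc, mul_comm σ 7,
    mul_assoc (7 * σ)]
  refine mul_le_mul_of_nonneg_left ?_ (by positivity)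
  calc _ ≤ Real.exp (max (-(c * Real.log p)) (-(#J₀ * Real.log p))
        - 3 * (#(J \ J₀) + #(J₀ \ J)) * Real.log p) := by
        refine Real.exp_le_exp.2 (le_trans (le_of_eq ?_) hexp)
        rw [hR, hd, hJ, hJ₀]
        field_simp
        ring
    _ = max (Real.exp (-(c * Real.log p))) (Real.exp (-(#J₀ * Real.log p)))
        * Real.exp (-(3 * #(symmDiff J J₀) * Real.log p)) := by
        rw [sub_eq_add_neg, Real.exp_add, Real.exp_monotone.map_max, hd]
    _ ≤ _ := by
        refine mul_le_mul_of_nonneg_right (max_le ?_ ?_) (Real.exp_nonneg _)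
        · exact le_add_of_nonneg_right (Real.exp_nonneg _)
        · exact le_add_of_nonneg_left (Real.exp_nonneg _)

lemma measureReal_norm_mul_lt_abs_inner_le {κ : Type*} [Fintype κ] (v : ℝ≥0)
    (r : EuclideanSpace ℝ κ) {t : ℝ} (ht : 0 ≤ t) :
    (Measure.pi fun _ : κ => gaussianReal 0 v).real
      {z | ‖r‖ * t < |⟪r, WithLp.toLp 2 z⟫|} ≤ 2 * Real.exp (-t ^ 2 / (2 * v)) := by
  rcases eq_or_ne r 0 with rfl | hr
  · simp only [norm_zero, zero_mul, inner_zero_left, abs_zero, lt_irrefl, Set.ofPred_false,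
      measureReal_empty]
    positivity
  · have hr' : 0 < ‖r‖ := norm_pos_iff.2 hr
    refine le_trans (le_of_eq ?_)
      (measureReal_lt_abs_inner_le v (‖r‖⁻¹ • r) (norm_smul_inv_norm hr) ht)
    congr 1
    ext z
    change (_ : ℝ) < _ ↔ (_ : ℝ) < _
    rw [real_inner_smul_left, abs_mul, abs_of_pos (inv_pos.2 hr'), ← div_eq_inv_mul,
      lt_div_iff₀ hr', mul_comm]

/-- The noise is well behaved with respect to the columns in `J₀` and to all noise spaces. -/
def IsGoodNoise {p : ℕ} {V : Type*} [NormedAddCommGroup V] [InnerProductSpace ℝ V]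
    [FiniteDimensional ℝ V] (x : Fin p → V) (f : V) (J₀ : Finset (Fin p)) (c σ : ℝ) (z : V) :
    Prop :=
  (∀ j ∈ J₀, |⟪x j - (colSpan x (J₀.erase j)).starProjection (x j), z⟫|
      ≤ ‖x j - (colSpan x (J₀.erase j)).starProjection (x j)‖
        * (σ * √(2 * (c + 1) * Real.log p))) ∧
  ∀ J ≠ J₀, ‖(noiseSpace x f J₀ J).starProjection z‖ ^ 2
      ≤ 4 * (c + 3 * #(symmDiff J J₀)) * Real.log p * σ ^ 2

lemma sqrt_two_pow_mul_exp_le {p m d : ℕ} (hp : 2 ≤ p) (hm : m ≤ d) (hd : 1 ≤ d) (c : ℝ) :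
    √2 ^ (m + 1) * Real.exp (-((c + 3 * d) * Real.log p))
      ≤ Real.exp (-(c * Real.log p)) * Real.exp (-(2 * d * Real.log p)) := by
  have hp0 : (0 : ℝ) < p := by positivity
  have h1 : √2 ^ (m + 1) ≤ Real.exp (d * Real.log p) := by
    calc √2 ^ (m + 1) ≤ √2 ^ (2 * d) := by
          gcongr
          · exact Real.one_le_sqrt.2 (by norm_num)
          · omega
      _ = 2 ^ d := by rw [pow_mul, Real.sq_sqrt (by norm_num)]
      _ ≤ (p : ℝ) ^ d := by gcongr; exact_mod_cast hp
      _ = _ := by rw [Real.exp_nat_mul, Real.exp_log hp0]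
  refine (mul_le_mul_of_nonneg_right h1 (Real.exp_nonneg _)).trans (le_of_eq ?_)
  rw [← Real.exp_add, ← Real.exp_add]
  congr 1
  ring

lemma measureReal_not_isGoodNoise_le {n p : ℕ} (hp : 2 ≤ p) (x : Fin p → EuclideanSpace ℝ (Fin n))
    (f : EuclideanSpace ℝ (Fin n)) (J₀ : Finset (Fin p)) {c σ : ℝ} (hc : 1 ≤ c) (hσ : 0 < σ) :
    (Measure.pi fun _ : Fin n => gaussianReal 0 (Real.toNNReal (σ ^ 2))).real
      {z | ¬ IsGoodNoise x f J₀ c σ (WithLp.toLp 2 z)} ≤ 4 * Real.exp (-(c * Real.log p)) := by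
  set μ := Measure.pi fun _ : Fin n => gaussianReal 0 (Real.toNNReal (σ ^ 2)) with hμ
  have hv : (Real.toNNReal (σ ^ 2) : ℝ) = σ ^ 2 := Real.coe_toNNReal _ (by positivity)
  have hv0 : Real.toNNReal (σ ^ 2) ≠ 0 := by
    rw [← NNReal.coe_ne_zero, hv]; positivity
  have hp0 : (0 : ℝ) < p := by positivity
  have hL : 0 ≤ Real.log p := Real.log_nonneg (by exact_mod_cast (by omega : 1 ≤ p))
  set r : Fin p → EuclideanSpace ℝ (Fin n) :=
    fun j => x j - (colSpan x (J₀.erase j)).starProjection (x j) with hr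
  set T := σ * √(2 * (c + 1) * Real.log p) with hT
  have hsub : {z : Fin n → ℝ | ¬ IsGoodNoise x f J₀ c σ (WithLp.toLp 2 z)} ⊆
      (⋃ j ∈ J₀, {z | ‖r j‖ * T < |⟪r j, WithLp.toLp 2 z⟫|}) ∪
      ⋃ J ∈ Finset.univ.erase J₀, {z | (4 * (c + 3 * #(symmDiff J J₀)) * Real.log p)
        * (Real.toNNReal (σ ^ 2) : ℝ)
          < ‖(noiseSpace x f J₀ J).starProjection (WithLp.toLp 2 z)‖ ^ 2} := by
    intro z hz
    change ¬ (_ ∧ _) at hz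
    rw [hv]
    by_contra hcon
    apply hz
    simp only [Set.mem_union, Set.mem_iUnion, not_or, not_exists] at hcon
    exact ⟨fun j hj => not_lt.1 (hcon.1 j hj),
      fun J hJ => not_lt.1 (hcon.2 J (by simp [hJ]))⟩
  refine (measureReal_mono hsub).trans ((measureReal_union_le _ _).trans ?_)
  have h1 : μ.real (⋃ j ∈ J₀, {z | ‖r j‖ * T < |⟪r j, WithLp.toLp 2 z⟫|})
      ≤ 2 * Real.exp (-(c * Real.log p)) := by
    refine (measureReal_biUnion_finset_le _ _).trans ?_
    calc _ ≤ ∑ j ∈ J₀, 2 * Real.exp (-((c + 1) * Real.log p)) := by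
          refine Finset.sum_le_sum fun j _ =>
            (measureReal_norm_mul_lt_abs_inner_le _ (r j) (by positivity)).trans (le_of_eq ?_)
          rw [hv, hT, mul_pow, Real.sq_sqrt (by positivity)]
          congr 2
          field_simp
      _ ≤ p * (2 * Real.exp (-((c + 1) * Real.log p))) := by
          rw [Finset.sum_const, nsmul_eq_mul]
          gcongr
          simpa using Finset.card_le_univ J₀
      _ = _ := by
          rw [add_mul, neg_add, Real.exp_add, one_mul, Real.exp_neg (Real.log p),
            Real.exp_log hp0]
          field_simp
  have h2 : μ.real (⋃ J ∈ Finset.univ.erase J₀, {z | (4 * (c + 3 * #(symmDiff J J₀)) * Real.log p)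
        * (Real.toNNReal (σ ^ 2) : ℝ)
          < ‖(noiseSpace x f J₀ J).starProjection (WithLp.toLp 2 z)‖ ^ 2})
      ≤ 2 * Real.exp (-(c * Real.log p)) := by
    refine (measureReal_biUnion_finset_le _ _).trans ?_
    calc _ ≤ ∑ J ∈ Finset.univ.erase J₀, Real.exp (-(c * Real.log p))
            * Real.exp (-(2 * #(symmDiff J J₀) * Real.log p)) := by
          refine Finset.sum_le_sum fun J hJ =>
            (measureReal_lt_norm_starProjection_sq_le hv0 _ _).trans ?_
          have hd : 1 ≤ #(symmDiff J J₀) :=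
            Finset.card_pos.2 (Finset.symmDiff_nonempty.2 (Finset.ne_of_mem_erase hJ))
          refine le_trans ?_ (sqrt_two_pow_mul_exp_le (d := #(symmDiff J J₀)) hp
            (Finset.card_le_card (Finset.subset_union_left : J \ J₀ ⊆ symmDiff J J₀)) hd c)
          refine mul_le_mul (pow_le_pow_right₀ (Real.one_le_sqrt.2 (by norm_num))
            (finrank_noiseSpace_le x f J₀ J)) (le_of_eq ?_) (Real.exp_nonneg _) (by positivity)
          congr 1
          ring
      _ ≤ Real.exp (-(c * Real.log p))
            * ∑ J, Real.exp (-(2 * #(symmDiff J J₀) * Real.log p)) := by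
          rw [Finset.mul_sum]
          exact Finset.sum_le_sum_of_subset_of_nonneg (Finset.erase_subset _ _)
            fun _ _ _ => by positivity
      _ ≤ Real.exp (-(c * Real.log p)) * 2 := by
          gcongr
          exact (sum_exp_card_symmDiff_le hp J₀).trans (by norm_num)
      _ = _ := mul_comm _ _
  linarith

lemma exp_neg_three_mul_le {p d : ℕ} (hp : 2 ≤ p) (hd : 1 ≤ d) :
    Real.exp (-(3 * d * Real.log p)) ≤ 1 / 2 * Real.exp (-(2 * d * Real.log p)) := by
  have h : Real.exp (-(d * Real.log p)) ≤ 1 / 2 := by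
    rw [Real.exp_neg, Real.exp_nat_mul, Real.exp_log (by positivity), one_div]
    refine inv_anti₀ (by norm_num) ?_
    calc (2 : ℝ) ≤ p := by exact_mod_cast hp
      _ = (p : ℝ) ^ 1 := (pow_one _).symm
      _ ≤ (p : ℝ) ^ d := by
        gcongr
        exact_mod_cast (by omega : 1 ≤ p)
  refine le_trans (le_of_eq ?_) (mul_le_mul_of_nonneg_right h (Real.exp_nonneg _))
  rw [← Real.exp_add]
  congr 1
  ring

/-- On the good noise event, the posterior mean is close to the true coefficients. -/
lemma abs_posterior_mean_sub_le {p : ℕ} (hp : 2 ≤ p) {V : Type*} [NormedAddCommGroup V]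
    [InnerProductSpace ℝ V] [FiniteDimensional ℝ V] {x : Fin p → V} {β : Fin p → ℝ}
    {J₀ : Finset (Fin p)} {z : V} {c ε lam σ κ₀ κ₁ κ : ℝ} {k : ℕ} (hc : 1 ≤ c) (hε : 0 < ε)
    (hσ : 0 < σ) (hlam : lam = (((1 + ε) * (23 + 5 * c) + 1) / ε) * Real.log p)
    (hlam2 : (62 + 4 * c) * Real.log p ≤ lam) (hκ₀ : 0 < κ₀) (hκ : 0 < κ) (hk : #J₀ ≤ k)
    (hβ : ∀ j ∉ J₀, β j = 0) (hB : ∀ j ∈ J₀, 9 * σ ^ 2 * lam ≤ κ₁ ^ 2 * β j ^ 2)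
    (hlow₀ : ∀ u : Fin p → ℝ, (∀ j ∉ J₀, u j = 0) →
      κ₀ ^ 2 * ∑ j, u j ^ 2 ≤ ‖∑ j, u j • x j‖ ^ 2)
    (hlow₁ : ∀ J : Finset (Fin p), (#J : ℝ) ≤ (2 + ε) * #J₀ → ∀ u : Fin p → ℝ,
      (∀ j ∉ J, u j = 0) → κ₁ ^ 2 * ∑ j, u j ^ 2 ≤ ‖∑ j, u j • x j‖ ^ 2)
    (hlow : ∀ J : Finset (Fin p), #J ≤ #J₀ + k → ∀ u : Fin p → ℝ,
      (∀ j ∉ J, u j = 0) → κ ^ 2 * ∑ j, u j ^ 2 ≤ ‖∑ j, u j • x j‖ ^ 2)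
    (hz : IsGoodNoise x (∑ j, β j • x j) J₀ c σ z) {W : Finset (Fin p) → ℝ}
    (hW : ∀ J, W J = if #J ≤ k then modelWeight p lam σ #J
      (‖∑ j, β j • x j + z - (colSpan x J).starProjection (∑ j, β j • x j + z)‖ ^ 2) else 0)
    {b : Finset (Fin p) → Fin p → ℝ} (hb0 : ∀ J, ∀ j ∉ J, b J j = 0)
    (hb : ∀ J, ∑ j, b J j • x j = (colSpan x J).starProjection (∑ j, β j • x j + z))
    (j : Fin p) :
    |∑ J, W J / (∑ J', W J') * b J j - β j| ≤ σ * √(2 * (c + 1) * Real.log p) / κ₀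
      + 6 * σ / κ * (Real.exp (-(c * Real.log p)) + Real.exp (-(#J₀ * Real.log p))) := by
  set f := ∑ j, β j • x j with hf
  set E := Real.exp (-(c * Real.log p)) + Real.exp (-(#J₀ * Real.log p)) with hE
  have hfJ : f ∈ colSpan x J₀ := mem_colSpan_iff.2 ⟨β, hβ, rfl⟩
  have hW0 : ∀ J, 0 ≤ W J := fun J => by
    rw [hW]
    split_ifs
    · unfold modelWeight; positivity
    · rfl
  have hWJ₀ : 0 < W J₀ := by
    have : 0 < p.choose #J₀ := Nat.choose_pos (by simpa using Finset.card_le_univ J₀)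
    rw [hW, if_pos hk]
    unfold modelWeight
    positivity
  have hWS : W J₀ ≤ ∑ J, W J := Finset.single_le_sum (fun J _ => hW0 J) (Finset.mem_univ J₀)
  have hS : 0 < ∑ J, W J := hWJ₀.trans_le hWS
  have hmain : |b J₀ j - β j| ≤ σ * √(2 * (c + 1) * Real.log p) / κ₀ := by
    by_cases hj : j ∈ J₀
    · rw [le_div_iff₀ hκ₀]
      refine abs_coord_mul_le_of_abs_inner_le (u := fun i => b J₀ i - β i) hκ₀ hlow₀
        (fun i hi => by rw [hb0 J₀ i hi, hβ i hi, sub_zero]) ?_ hj (hz.1 j hj)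
      simp_rw [sub_smul, Finset.sum_sub_distrib]
      rw [hb, ← hf, map_add, Submodule.starProjection_eq_self_iff.2 hfJ, add_sub_cancel_left]
    · rw [hb0 J₀ j hj, hβ j hj, sub_zero, abs_zero]
      positivity
  have hcoord : ∀ J, #J ≤ k → |b J j - b J₀ j| ≤
      ‖(colSpan x J).starProjection (f + z) - (colSpan x J₀).starProjection (f + z)‖ / κ := by
    intro J hJ
    rw [le_div_iff₀ hκ, ← hb, ← hb, ← Finset.sum_sub_distrib]
    simp_rw [← sub_smul]
    refine le_of_sq_le_sq ?_ (norm_nonneg _)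
    refine le_trans ?_ (hlow (J₀ ∪ J) ((Finset.card_union_le _ _).trans (by omega)) _ ?_)
    · rw [mul_pow, sq_abs, mul_comm]
      gcongr
      exact Finset.single_le_sum (f := fun i => (b J i - b J₀ i) ^ 2) (fun i _ => sq_nonneg _)
        (Finset.mem_univ j)
    · intro i hi
      rw [Finset.mem_union, not_or] at hi
      rw [hb0 J i hi.2, hb0 J₀ i hi.1, sub_zero]
  have hterm : ∀ J, W J * |b J j - b J₀ j|
      ≤ W J₀ * (7 / 2 * σ / κ * E) * Real.exp (-(2 * #(symmDiff J J₀) * Real.log p)) := by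
    intro J
    have hrhs : 0 ≤ W J₀ * (7 / 2 * σ / κ * E)
        * Real.exp (-(2 * #(symmDiff J J₀) * Real.log p)) := by positivity
    rcases eq_or_ne J J₀ with rfl | hne
    · simpa using hrhs
    by_cases hJ : #J ≤ k
    · refine (mul_le_mul_of_nonneg_left (hcoord J hJ) (hW0 J)).trans ?_
      rw [mul_div_assoc', div_le_iff₀ hκ]
      have h := modelWeight_mul_norm_sub_le (by omega) hfJ hc hε hσ hlam hlam2 hne
        (fun h => card_mul_le_norm_residual_sq hβ (hlow₁ _ h) hB) (hz.2 J hne)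
      have hWJ := hW J
      have hWJ' := hW J₀
      rw [if_pos hJ] at hWJ
      rw [if_pos hk] at hWJ'
      rw [← hWJ, ← hWJ'] at h
      refine h.trans ?_
      calc _ ≤ W J₀ * (7 * σ * E * (1 / 2 * Real.exp (-(2 * #(symmDiff J J₀) * Real.log p)))) := by
            gcongr
            exact exp_neg_three_mul_le hp (Finset.card_pos.2 (Finset.symmDiff_nonempty.2 hne))
        _ = _ := by field_simp
    · rw [hW, if_neg hJ, zero_mul]
      exact hrhs
  have hsum : ∑ J, W J * |b J j - b J₀ j| ≤ (∑ J, W J) * (6 * σ / κ * E) := by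
    calc _ ≤ ∑ J, W J₀ * (7 / 2 * σ / κ * E)
          * Real.exp (-(2 * #(symmDiff J J₀) * Real.log p)) := Finset.sum_le_sum fun J _ => hterm J
      _ ≤ W J₀ * (7 / 2 * σ / κ * E) * (33 / 20) := by
          rw [← Finset.mul_sum]
          gcongr
          exact sum_exp_card_symmDiff_le hp J₀
      _ = W J₀ * (231 / 40 * σ / κ * E) := by ring
      _ ≤ _ := by
          gcongr
          norm_num
  have hdecomp : ∑ J, W J / (∑ J', W J') * b J j - β j
      = (b J₀ j - β j) + (∑ J, W J * (b J j - b J₀ j)) / ∑ J', W J' := by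
    simp_rw [mul_sub, Finset.sum_sub_distrib, ← Finset.sum_mul, div_mul_eq_mul_div,
      ← Finset.sum_div]
    field_simp
    ring
  rw [hdecomp]
  refine (abs_add_le _ _).trans (add_le_add hmain ?_)
  rw [abs_div, abs_of_pos hS, div_le_iff₀ hS, mul_comm _ (∑ J, W J)]
  refine le_trans (Finset.abs_sum_le_sum_abs _ _) (le_trans (le_of_eq ?_) hsum)
  exact Finset.sum_congr rfl fun J _ => by rw [abs_mul, abs_of_nonneg (hW0 J)]

section

variable {n p : ℕ} (X : Matrix (Fin n) (Fin p) ℝ)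

lemma toLp_mulVec (u : Fin p → ℝ) :
    WithLp.toLp 2 (X.mulVec u) = ∑ j, u j • WithLp.toLp 2 (X.col j) := by
  ext i
  simp [Matrix.mulVec, dotProduct, mul_comm]

lemma norm_sum_smul_toLp_col_sq (u : Fin p → ℝ) :
    ‖∑ j, u j • WithLp.toLp 2 (X.col j)‖ ^ 2 = ∑ i, X.mulVec u i ^ 2 := by
  rw [← toLp_mulVec, EuclideanSpace.real_norm_sq_eq]

/-- The values whose infimum is the sparse minimal singular value at sparsity level `s`. -/
def sparseRatios (s : ℝ) : Set ℝ :=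
  {r : ℝ | ∃ (J : Finset (Fin p)) (u : Fin p → ℝ),
        (J.card : ℝ) ≤ s ∧ (∀ j ∉ J, u j = 0) ∧ (∑ j, (u j)^2) = 1 ∧
        r = Real.sqrt (∑ i, (X.mulVec u i)^2) / Real.sqrt n}

lemma zero_le_of_mem_sparseRatios {s r : ℝ} (hr : r ∈ sparseRatios X s) : 0 ≤ r := by
  obtain ⟨J, u, -, -, -, rfl⟩ := hr
  positivity

lemma sInf_sparseRatios_anti {s t : ℝ} (hp : 0 < p) (hs : 1 ≤ s) (hst : s ≤ t) :
    sInf (sparseRatios X t) ≤ sInf (sparseRatios X s) := by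
  refine csInf_le_csInf ⟨0, fun r hr => zero_le_of_mem_sparseRatios X hr⟩ ?_ ?_
  · refine ⟨_, {⟨0, hp⟩}, Pi.single ⟨0, hp⟩ 1, by simpa using hs, fun j hj => ?_, ?_, rfl⟩
    · simpa [Pi.single_apply] using hj
    · simp [Pi.single_apply]
  · rintro r ⟨J, u, hJ, h⟩
    exact ⟨J, u, hJ.trans hst, h⟩

lemma sqrt_mul_sInf_sparseRatios_sq_mul_le (hn : 0 < n) {s : ℝ} {J : Finset (Fin p)}
    (hJ : (#J : ℝ) ≤ s) {u : Fin p → ℝ} (hu : ∀ j ∉ J, u j = 0) :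
    (√n * sInf (sparseRatios X s)) ^ 2 * ∑ j, u j ^ 2
      ≤ ‖∑ j, u j • WithLp.toLp 2 (X.col j)‖ ^ 2 := by
  rw [norm_sum_smul_toLp_col_sq]
  set N := ∑ j, u j ^ 2 with hN
  have hN0 : 0 ≤ N := Finset.sum_nonneg fun _ _ => sq_nonneg _
  rcases hN0.eq_or_lt with h0 | hN0
  · rw [← h0, mul_zero]
    exact Finset.sum_nonneg fun _ _ => sq_nonneg _
  have hn' : (0 : ℝ) < n := by exact_mod_cast hn
  have hmem : √(∑ i, X.mulVec ((√N)⁻¹ • u) i ^ 2) / √n ∈ sparseRatios X s := by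
    refine ⟨J, (√N)⁻¹ • u, hJ, fun j hj => by simp [hu j hj], ?_, rfl⟩
    simp only [Pi.smul_apply, smul_eq_mul, mul_pow, ← Finset.mul_sum, inv_pow, Real.sq_sqrt hN0.le]
    exact inv_mul_cancel₀ hN0.ne'
  have hle := csInf_le ⟨0, fun r hr => zero_le_of_mem_sparseRatios X hr⟩ hmem
  rw [le_div_iff₀ (by positivity), mul_comm] at hle
  have h0 : 0 ≤ sInf (sparseRatios X s) :=
    Real.sInf_nonneg fun r hr => zero_le_of_mem_sparseRatios X hr
  have h1 := pow_le_pow_left₀ (by positivity) hle 2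
  rw [Real.sq_sqrt (Finset.sum_nonneg fun _ _ => sq_nonneg _), Matrix.mulVec_smul] at h1
  simp only [Pi.smul_apply, smul_eq_mul, mul_pow _ _ 2, ← Finset.mul_sum, inv_pow,
    Real.sq_sqrt hN0.le] at h1
  rw [← div_eq_inv_mul, le_div_iff₀ hN0] at h1
  rwa [mul_pow]

end

lemma toLp_eq_starProjection_colSpan {n p : ℕ} {X : Matrix (Fin n) (Fin p) ℝ}
    {J : Finset (Fin p)} {v w : Fin n → ℝ}
    (hw : ∃ u : Fin p → ℝ, (∀ j ∉ J, u j = 0) ∧ w = X.mulVec u)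
    (horth : ∀ j ∈ J, ∑ i, (v i - w i) * X i j = 0) :
    WithLp.toLp 2 w
      = (colSpan (fun j => WithLp.toLp 2 (X.col j)) J).starProjection (WithLp.toLp 2 v) := by
  symm
  refine Submodule.eq_starProjection_of_mem_of_inner_eq_zero ?_ fun y hy => ?_
  · obtain ⟨u, hu, rfl⟩ := hw
    exact mem_colSpan_iff.2 ⟨u, hu, (toLp_mulVec X u).symm⟩
  · induction hy using Submodule.span_induction with
    | mem y hy =>
      obtain ⟨j, hj, rfl⟩ := hy
      rw [← horth j hj]
      simp [PiLp.inner_apply, mul_comm]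
    | zero => simp
    | add a b _ _ ha hb => rw [inner_add_right, ha, hb, add_zero]
    | smul c a _ ha => rw [inner_smul_right, ha, mul_zero]

lemma rpow_neg_add_inv_pow_le {p s : ℕ} (hp : 2 ≤ p) (hs : 1 ≤ s) (c : ℝ) :
    Real.exp (-(c * Real.log p)) + Real.exp (-(s * Real.log p))
      ≤ 2 * √s / (p : ℝ) ^ c + 1 / (p : ℝ) ^ s := by
  have hp0 : (0 : ℝ) < p := by positivity
  rw [Real.exp_neg (s * _), Real.exp_nat_mul, Real.exp_log hp0, Real.exp_neg, mul_comm c,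
    ← Real.rpow_def_of_pos hp0, one_div, div_eq_mul_inv]
  gcongr
  refine le_mul_of_one_le_left (by positivity) ?_
  have : 1 ≤ √(s : ℝ) := Real.one_le_sqrt.2 (by exact_mod_cast hs)
  linarith

end

theorem stmt10
    (n p : ℕ) (hn : 1 ≤ n) (hnp : n ≤ p) (hp2 : 2 ≤ p)
    (X : Matrix (Fin n) (Fin p) ℝ)
    (hX : ∀ j, Real.sqrt (∑ i, (X i j)^2) = Real.sqrt n)
    (σ : ℝ) (hσ : 0 < σ)
    (βs : Fin p → ℝ) (sstar : ℕ) (hs1 : 1 ≤ sstar)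
    (Jstar : Finset (Fin p)) (hJstar : Jstar = Finset.univ.filter (fun j => βs j ≠ 0))
    (hcard : Jstar.card = sstar)
    (P : Finset (Fin p) → (Fin n → ℝ) → (Fin n → ℝ))
    (hP : ∀ (J : Finset (Fin p)) (v : Fin n → ℝ),
        (∃ cf : Fin p → ℝ, (∀ j ∉ J, cf j = 0) ∧ P J v = X.mulVec cf)
        ∧ ∀ j ∈ J, (∑ i, (v i - P J v i) * X i j) = 0)
    (μ : Measure (Fin n → ℝ))
    (hμ : μ = Measure.pi (fun _ : Fin n => gaussianReal 0 (Real.toNNReal (σ^2))))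
    (hminimal : ∀ b : Fin p → ℝ, X.mulVec b = X.mulVec βs →
        sstar ≤ (Finset.univ.filter (fun j => b j ≠ 0)).card)
    (y : (Fin n → ℝ) → Fin n → ℝ)
    (hy : ∀ z i, y z i = X.mulVec βs i + z i)
    (sbar : ℕ) (hsbar1 : sstar ≤ sbar) (hsbar2 : sbar ≤ p)
    (lam : ℝ)
    (w Post : (Fin n → ℝ) → Finset (Fin p) → ℝ)
    (hw : ∀ z J, w z J = if J.card ≤ sbar then
        ((p.choose J.card : ℝ))⁻¹ * Real.exp (-(lam * (J.card : ℝ)))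
          * Real.exp (-(∑ i, (y z i - P J (y z) i)^2) / (2 * σ^2)) else 0)
    (hPost : ∀ z J, Post z J = w z J / ∑ J' : Finset (Fin p), w z J')
    (bh : (Fin n → ℝ) → Finset (Fin p) → Fin p → ℝ)
    (hbh : ∀ z J, (∀ j ∉ J, bh z J j = 0)
        ∧ X.mulVec (bh z J) = P J (y z)
        ∧ ∀ b : Fin p → ℝ, (∀ j ∉ J, b j = 0) → X.mulVec b = P J (y z) →
            ∑ j, (bh z J j)^2 ≤ ∑ j, (b j)^2)
    (nu : ℝ → ℝ)
    (hnu : ∀ s : ℝ, nu s = sInf {r : ℝ | ∃ (J : Finset (Fin p)) (u : Fin p → ℝ),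
        (J.card : ℝ) ≤ s ∧ (∀ j ∉ J, u j = 0) ∧ (∑ j, (u j)^2) = 1 ∧
        r = Real.sqrt (∑ i, (X.mulVec u i)^2) / Real.sqrt n})
    (ε c : ℝ) (hε : 0 < ε) (hc : 1 ≤ c)
    (hI : 0 < nu ((2 + ε) * (sstar : ℝ)))
    (hIss : 0 < nu ((sstar : ℝ) + (sbar : ℝ)))
    (hlam : lam = (((1 + ε) * (23 + 5 * c) + 1) / ε) * Real.log p)
    (hlam2 : (62 + 4 * c) * Real.log p ≤ lam)
    (hbmin : ∀ j ∈ Jstar,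
        3 * σ * Real.sqrt (lam / n) / nu ((2 + ε) * (sstar : ℝ)) ≤ |βs j|)
    :
    ENNReal.ofReal (1 - 4 * (p : ℝ) ^ (-c)) ≤
      μ {z | ∀ j,
        |(∑ J : Finset (Fin p), Post z J * bh z J j) - βs j|
          ≤ σ * Real.sqrt (2 * (c + 1) * Real.log p
                / ((n : ℝ) * (nu (sstar : ℝ))^2))
            + (2 * Real.sqrt 10 * σ / (Real.sqrt n * nu ((sstar : ℝ) + (sbar : ℝ)))) *
              (2 * Real.sqrt (sstar : ℝ) / (p : ℝ) ^ c + 1 / (p : ℝ) ^ (sstar : ℕ))} := by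
  have hp : 0 < p := by omega
  have hp0 : (0 : ℝ) < p := by positivity
  have hn' : (0 : ℝ) < n := by exact_mod_cast hn
  have hs' : (1 : ℝ) ≤ sstar := by exact_mod_cast hs1
  have hL : 0 ≤ Real.log p := Real.log_nonneg (by exact_mod_cast hp)
  have hlam0 : 0 ≤ lam := le_trans (by positivity) hlam2
  change ∀ s, nu s = sInf (sparseRatios X s) at hnu
  set x : Fin p → EuclideanSpace ℝ (Fin n) := fun j => WithLp.toLp 2 (X.col j) with hx
  have hlow : ∀ s : ℝ, ∀ J : Finset (Fin p), (#J : ℝ) ≤ s → ∀ u : Fin p → ℝ,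
      (∀ j ∉ J, u j = 0) → (√n * nu s) ^ 2 * ∑ j, u j ^ 2 ≤ ‖∑ j, u j • x j‖ ^ 2 := by
    intro s J hJ u hu
    rw [hnu]
    exact sqrt_mul_sInf_sparseRatios_sq_mul_le X hn hJ hu
  have hν₀ : 0 < nu sstar := hIss.trans_le (by
    rw [hnu, hnu]
    exact sInf_sparseRatios_anti X hp hs' (by simp))
  have hB : ∀ j ∈ Jstar,
      9 * σ ^ 2 * lam ≤ (√n * nu ((2 + ε) * (sstar : ℝ))) ^ 2 * βs j ^ 2 := by
    intro j hj
    have h := hbmin j hj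
    rw [div_le_iff₀ hI] at h
    have h2 := pow_le_pow_left₀ (by positivity) h 2
    rw [mul_pow, mul_pow, mul_pow, Real.sq_sqrt (by positivity), sq_abs, mul_div_assoc',
      div_le_iff₀ hn'] at h2
    rw [mul_pow, Real.sq_sqrt hn'.le]
    linarith
  have hsupp : ∀ j ∉ Jstar, βs j = 0 := by
    intro j hj
    simpa [hJstar] using hj
  have hproj : ∀ J v, WithLp.toLp 2 (P J v) = (colSpan x J).starProjection (WithLp.toLp 2 v) :=
    fun J v => toLp_eq_starProjection_colSpan (hP J v).1 (hP J v).2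
  have hy' : ∀ z, WithLp.toLp 2 (y z) = ∑ j, βs j • x j + WithLp.toLp 2 z := by
    intro z
    rw [← toLp_mulVec]
    ext i
    simp [hy]
  have hgood : ∀ z, IsGoodNoise x (∑ j, βs j • x j) Jstar c σ (WithLp.toLp 2 z) → ∀ j,
      |(∑ J : Finset (Fin p), Post z J * bh z J j) - βs j|
          ≤ σ * Real.sqrt (2 * (c + 1) * Real.log p
                / ((n : ℝ) * (nu (sstar : ℝ))^2))
            + (2 * Real.sqrt 10 * σ / (Real.sqrt n * nu ((sstar : ℝ) + (sbar : ℝ)))) *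
              (2 * Real.sqrt (sstar : ℝ) / (p : ℝ) ^ c + 1 / (p : ℝ) ^ (sstar : ℕ)) := by
    intro z hz j
    have h := abs_posterior_mean_sub_le hp2 hc hε hσ hlam hlam2
      (κ₀ := √n * nu sstar) (κ₁ := √n * nu ((2 + ε) * (sstar : ℝ)))
      (κ := √n * nu ((sstar : ℝ) + (sbar : ℝ))) (k := sbar) (W := w z) (b := bh z)
      (by positivity) (by positivity) (hcard ▸ hsbar1) hsupp hB
      (hlow _ _ (by exact_mod_cast hcard.le))
      (fun J hJ => hlow _ J (by rwa [hcard] at hJ))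
      (fun J hJ => hlow _ J (by rw [hcard] at hJ; exact_mod_cast hJ)) hz
      (fun J => by
        rw [hw, ← hy', ← hproj, ← WithLp.toLp_sub, EuclideanSpace.real_norm_sq_eq]
        rfl)
      (fun J => (hbh z J).1)
      (fun J => by rw [← toLp_mulVec, (hbh z J).2.1, hproj, hy']) j
    simp_rw [← hPost] at h
    refine h.trans (add_le_add (le_of_eq ?_) ?_)
    · rw [mul_div_assoc, Real.sqrt_div (by positivity), Real.sqrt_mul hn'.le, Real.sqrt_sq hν₀.le]
    · rw [hcard]
      refine mul_le_mul ?_ (rpow_neg_add_inv_pow_le hp2 hs1 c) (by positivity) (by positivity)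
      have h10 : 3 ≤ √10 := Real.le_sqrt_of_sq_le (by norm_num)
      gcongr
      linarith
  have hμp : IsProbabilityMeasure μ := by
    rw [hμ]
    infer_instance
  have hbad := measureReal_not_isGoodNoise_le hp2 x (∑ j, βs j • x j) Jstar hc hσ
  rw [← hμ, neg_mul_eq_neg_mul, mul_comm (-c), ← Real.rpow_def_of_pos hp0] at hbad
  rw [ENNReal.ofReal_le_iff_le_toReal (measure_ne_top _ _)]
  set A := {z : Fin n → ℝ | ¬ IsGoodNoise x (∑ j, βs j • x j) Jstar c σ (WithLp.toLp 2 z)}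
  have hcover : 1 ≤ μ.real Aᶜ + μ.real A := by
    rw [← probReal_univ (μ := μ), ← Set.compl_union_self A]
    exact measureReal_union_le _ _
  have hmono := measureReal_mono (μ := μ) (s₁ := Aᶜ) fun z hz => hgood z (not_not.1 hz)
  change _ ≤ μ.real _
  refine le_trans ?_ hmono
  linarith
end

section
/- For any c > 0, with probability at least 1 − p^(−c) over the Gaussian noise z, simultaneously for all subsets J ⊆ {1,…,p}: ‖P_J z‖₂² ≤ (20 + 4c)·σ²·|J|·log p. -/
open MeasureTheory ProbabilityTheory Finset
open scoped Classical ENNReal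

/-- The moment generating function at `1 / 4` of the square of a standard Gaussian variable. -/
lemma integral_exp_sq_div_four_gaussianReal :
    ∫ x, Real.exp (1 / 4 * x ^ 2) ∂(gaussianReal 0 1) = √2 := by
  rw [integral_gaussianReal_eq_integral_smul one_ne_zero]
  have h (x : ℝ) : gaussianPDFReal 0 1 x • Real.exp (1 / 4 * x ^ 2) =
      (√(2 * Real.pi))⁻¹ * Real.exp (-(1 / 4) * x ^ 2) := by
    rw [gaussianPDFReal_def, smul_eq_mul, mul_assoc, ← Real.exp_add]
    simp only [NNReal.coe_one, mul_one, sub_zero]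
    ring_nf
  simp_rw [h]
  rw [integral_const_mul, integral_gaussian, ← Real.sqrt_inv, ← Real.sqrt_mul (by positivity)]
  congr 1
  field_simp
  norm_num

section StdGaussian

variable {E : Type*} [NormedAddCommGroup E] [InnerProductSpace ℝ E] [FiniteDimensional ℝ E]
  [MeasurableSpace E] [BorelSpace E]

lemma integral_exp_norm_sq_div_four_stdGaussian :
    ∫ x, Real.exp (1 / 4 * ‖x‖ ^ 2) ∂(stdGaussian E) = √2 ^ Module.finrank ℝ E := by
  rw [stdGaussian, integral_map (Measurable.aemeasurable (by fun_prop))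
    (Measurable.aestronglyMeasurable (by fun_prop))]
  have h (x : Fin (Module.finrank ℝ E) → ℝ) :
      Real.exp (1 / 4 * ‖∑ i, x i • stdOrthonormalBasis ℝ E i‖ ^ 2) =
        ∏ i, Real.exp (1 / 4 * x i ^ 2) := by
    rw [← Real.exp_sum, ← Finset.mul_sum, ← real_inner_self_eq_norm_sq,
      (stdOrthonormalBasis ℝ E).orthonormal.inner_sum]
    simp [pow_two]
  simp_rw [h]
  rw [integral_fintype_prod_eq_prod (f := fun _ x ↦ Real.exp (1 / 4 * x ^ 2))]
  simp [integral_exp_sq_div_four_gaussianReal, -one_div]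

/-- A Chernoff bound for the squared norm of a standard Gaussian vector. -/
lemma stdGaussian_real_le_norm_sq (t : ℝ) :
    (stdGaussian E).real {x | t ≤ ‖x‖ ^ 2} ≤
      Real.exp (-(1 / 4) * t) * √2 ^ Module.finrank ℝ E := by
  rw [← integral_exp_norm_sq_div_four_stdGaussian (E := E)]
  refine measure_ge_le_exp_mul_mgf (X := fun x : E ↦ ‖x‖ ^ 2) (t := 1 / 4) t (by norm_num) ?_
  refine not_imp_comm.1 integral_undef ?_
  rw [integral_exp_norm_sq_div_four_stdGaussian]
  positivity

/-- The orthogonal projection of a standard Gaussian vector is a standard Gaussian vector. -/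
lemma stdGaussian_map_orthogonalProjectionOnto (S : Submodule ℝ E) :
    (stdGaussian E).map S.orthogonalProjectionOnto = stdGaussian S := by
  apply Measure.ext_of_charFun
  ext t
  rw [charFun_apply, integral_map (by fun_prop) (by fun_prop), charFun_stdGaussian]
  simp_rw [Submodule.inner_orthogonalProjectionOnto_eq_of_mem_right]
  rw [← charFun_apply, charFun_stdGaussian, Submodule.coe_norm]

end StdGaussian

lemma pi_gaussianReal_eq_map_stdGaussian {ι : Type*} [Fintype ι] (σ : ℝ) :
    Measure.pi (fun _ : ι ↦ gaussianReal 0 (Real.toNNReal (σ ^ 2))) =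
      (stdGaussian (EuclideanSpace ℝ ι)).map (fun x i ↦ σ * x i) := by
  have h : gaussianReal 0 (Real.toNNReal (σ ^ 2)) = (gaussianReal 0 1).map (σ * ·) := by
    rw [gaussianReal_map_const_mul, mul_zero, mul_one, Real.toNNReal_of_nonneg (sq_nonneg σ)]
  rw [← map_pi_eq_stdGaussian, Measure.map_map (by fun_prop) (by fun_prop), h]
  exact (Measure.pi_map_pi (fun _ ↦ by fun_prop)).symm

/-- A tail bound for the projection of Gaussian noise onto a subspace. -/
lemma pi_gaussianReal_real_le_norm_orthogonalProjectionOnto_sq {ι : Type*} [Fintype ι]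
    {σ : ℝ} (hσ : 0 < σ) (S : Submodule ℝ (EuclideanSpace ℝ ι)) (t : ℝ) :
    (Measure.pi (fun _ : ι ↦ gaussianReal 0 (Real.toNNReal (σ ^ 2)))).real
        {z | σ ^ 2 * t ≤ ‖S.orthogonalProjectionOnto (WithLp.toLp 2 z)‖ ^ 2} ≤
      Real.exp (-(1 / 4) * t) * √2 ^ Module.finrank ℝ S := by
  refine le_trans (le_of_eq ?_) (stdGaussian_real_le_norm_sq (E := S) t)
  rw [pi_gaussianReal_eq_map_stdGaussian, ← stdGaussian_map_orthogonalProjectionOnto,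
    map_measureReal_apply (by fun_prop) (measurableSet_le (by fun_prop) (by fun_prop)),
    map_measureReal_apply (by fun_prop) (measurableSet_le (by fun_prop) (by fun_prop))]
  congr 1
  ext x
  have h : WithLp.toLp 2 (fun i ↦ σ * x i) = σ • x := rfl
  simp only [Set.mem_preimage, Set.mem_ofPred_eq, h, map_smul, norm_smul, mul_pow,
    Real.norm_eq_abs, sq_abs]
  exact mul_le_mul_iff_right₀ (by positivity)

/-- A vector in the span of the columns indexed by `J`, with residual orthogonal to these
columns, is the orthogonal projection onto that span. -/
lemma norm_orthogonalProjectionOnto_span_columns_sq {m κ : Type*} [Fintype m] [Fintype κ]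
    (X : Matrix m κ ℝ) (J : Finset κ) (v w : m → ℝ)
    (hw : ∃ cf : κ → ℝ, (∀ j ∉ J, cf j = 0) ∧ w = X.mulVec cf)
    (hvw : ∀ j ∈ J, ∑ i, (v i - w i) * X i j = 0) :
    ‖(Submodule.span ℝ (J.image fun j ↦ WithLp.toLp 2 (fun i ↦ X i j) :
      Set (EuclideanSpace ℝ m))).orthogonalProjectionOnto (WithLp.toLp 2 v)‖ ^ 2 =
      ∑ i, w i ^ 2 := by
  obtain ⟨cf, hcf, hwX⟩ := hw
  set S := Submodule.span ℝ (J.image fun j ↦ WithLp.toLp 2 (fun i ↦ X i j) :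
      Set (EuclideanSpace ℝ m))
  have hmem : WithLp.toLp 2 w ∈ S := by
    have h : (WithLp.toLp 2 w : EuclideanSpace ℝ m) =
        ∑ j ∈ J, cf j • WithLp.toLp 2 (fun i ↦ X i j) := by
      ext i
      rw [hwX]
      simp only [Matrix.mulVec, dotProduct, WithLp.ofLp_sum, WithLp.ofLp_smul, Finset.sum_apply,
        Pi.smul_apply, smul_eq_mul]
      rw [← Finset.sum_subset (Finset.subset_univ J)
        (fun j _ hj ↦ by rw [hcf j hj, mul_zero])]
      exact Finset.sum_congr rfl fun j _ ↦ mul_comm _ _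
    rw [h]
    exact Submodule.sum_mem _ fun j hj ↦ Submodule.smul_mem _ _
      (Submodule.subset_span (by simpa using ⟨j, hj, rfl⟩))
  have hproj : S.starProjection (WithLp.toLp 2 v) = WithLp.toLp 2 w := by
    refine Submodule.eq_starProjection_of_mem_of_inner_eq_zero hmem fun u hu ↦ ?_
    induction hu using Submodule.span_induction with
    | mem u hu =>
      obtain ⟨j, hj, rfl⟩ : ∃ j ∈ J, WithLp.toLp 2 (fun i ↦ X i j) = u := by simpa using hu
      rw [← hvw j hj]
      simp [PiLp.inner_apply, mul_comm]
    | zero => simp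
    | add a b _ _ ha hb => rw [inner_add_right, ha, hb, add_zero]
    | smul r a _ ha => rw [inner_smul_right, ha, mul_zero]
  calc ‖S.orthogonalProjectionOnto (WithLp.toLp 2 v)‖ ^ 2
      = ‖S.starProjection (WithLp.toLp 2 v)‖ ^ 2 := rfl
    _ = ∑ i, w i ^ 2 := by rw [hproj, EuclideanSpace.real_norm_sq_eq]

lemma sum_nonempty_pow_card_le {p : ℕ} {a : ℝ} (ha : 0 ≤ a) (hpa : p * a ≤ 1) :
    ∑ J : Finset (Fin p) with J.Nonempty, a ^ #J ≤ 2 * (p * a) := by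
  have htotal : ∑ J : Finset (Fin p), a ^ #J = (a + 1) ^ p := by
    simpa using Fin.sum_pow_mul_eq_add_pow (n := p) a 1
  have hfilter : (Finset.univ.filter fun J : Finset (Fin p) ↦ ¬ J.Nonempty) = {∅} := by
    ext J
    simp
  have hsplit := Finset.sum_filter_add_sum_filter_not Finset.univ
    (fun J : Finset (Fin p) ↦ J.Nonempty) (fun J ↦ a ^ #J)
  rw [hfilter, htotal, Finset.sum_singleton, Finset.card_empty, pow_zero] at hsplit
  have hexp : (a + 1) ^ p ≤ Real.exp (p * a) := by
    rw [Real.exp_nat_mul]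
    exact pow_le_pow_left₀ (by positivity) (Real.add_one_le_exp a) p
  have hpa0 : 0 ≤ p * a := by positivity
  have habs := (abs_le.1 (Real.abs_exp_sub_one_le (x := p * a) (by rwa [abs_of_nonneg hpa0]))).2
  rw [abs_of_nonneg hpa0] at habs
  linarith

/-- The union bound over all nonempty index sets. -/
lemma sum_nonempty_sqrt_two_mul_rpow_le {p : ℕ} (hp : 2 ≤ p) {c : ℝ} (hc : 0 < c) :
    ∑ J : Finset (Fin p) with J.Nonempty, (√2 * (p : ℝ) ^ (-(5 + c))) ^ #J ≤
      (p : ℝ) ^ (-c) := by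
  have hp' : (2 : ℝ) ≤ p := by exact_mod_cast hp
  have hp0 : (0 : ℝ) < p := by linarith
  have hpow : (p : ℝ) * (p : ℝ) ^ (-(5 + c)) = ((p : ℝ) ^ 4)⁻¹ * (p : ℝ) ^ (-c) := by
    rw [show -(5 + c) = -c - (5 : ℕ) by push_cast; ring, Real.rpow_sub_natCast hp0.ne']
    field_simp
  have hinv : ((p : ℝ) ^ 4)⁻¹ ≤ 1 / 16 := by
    rw [inv_le_comm₀ (by positivity) (by norm_num)]
    calc (1 / 16 : ℝ)⁻¹ = 2 ^ 4 := by norm_num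
      _ ≤ (p : ℝ) ^ 4 := by gcongr
  have hsqrt : √2 ≤ 2 := Real.sqrt_le_iff.2 (by norm_num)
  have hpc : (p : ℝ) ^ (-c) ≤ 1 := Real.rpow_le_one_of_one_le_of_nonpos (by linarith) (by linarith)
  have hpc0 : 0 < (p : ℝ) ^ (-c) := by positivity
  have hbound : p * (√2 * (p : ℝ) ^ (-(5 + c))) ≤ 1 / 8 * (p : ℝ) ^ (-c) := by
    calc p * (√2 * (p : ℝ) ^ (-(5 + c))) = √2 * (((p : ℝ) ^ 4)⁻¹ * (p : ℝ) ^ (-c)) := by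
          rw [← hpow]; ring
      _ ≤ 2 * (1 / 16 * (p : ℝ) ^ (-c)) := by gcongr
      _ = 1 / 8 * (p : ℝ) ^ (-c) := by ring
  refine (sum_nonempty_pow_card_le (by positivity) (by linarith)).trans (by linarith)

theorem stmt11
    (n p : ℕ) (hn : 1 ≤ n) (hnp : n ≤ p) (hp2 : 2 ≤ p)
    (X : Matrix (Fin n) (Fin p) ℝ)
    (hX : ∀ j, Real.sqrt (∑ i, (X i j)^2) = Real.sqrt n)
    (σ : ℝ) (hσ : 0 < σ)
    (P : Finset (Fin p) → (Fin n → ℝ) → (Fin n → ℝ))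
    (hP : ∀ (J : Finset (Fin p)) (v : Fin n → ℝ),
        (∃ cf : Fin p → ℝ, (∀ j ∉ J, cf j = 0) ∧ P J v = X.mulVec cf)
        ∧ ∀ j ∈ J, (∑ i, (v i - P J v i) * X i j) = 0)
    (μ : Measure (Fin n → ℝ))
    (hμ : μ = Measure.pi (fun _ : Fin n => gaussianReal 0 (Real.toNNReal (σ^2))))
    (c : ℝ) (hc : 0 < c)
    :
    ENNReal.ofReal (1 - (p : ℝ) ^ (-c)) ≤
      μ {z | ∀ J : Finset (Fin p),
        ∑ i, (P J z i)^2 ≤ (20 + 4 * c) * σ^2 * (J.card : ℝ) * Real.log p} := by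
  subst hμ
  set μ := Measure.pi (fun _ : Fin n => gaussianReal 0 (Real.toNNReal (σ^2)))
  have hp0 : (0 : ℝ) < p := by positivity
  set bad : Finset (Fin p) → Set (Fin n → ℝ) := fun J ↦
    {z | (20 + 4 * c) * σ^2 * (J.card : ℝ) * Real.log p ≤ ∑ i, (P J z i)^2}
  have hbad (J : Finset (Fin p)) :
      μ.real (bad J) ≤ (√2 * (p : ℝ) ^ (-(5 + c))) ^ #J := by
    set S := Submodule.span ℝ (J.image fun j ↦ WithLp.toLp 2 (fun i ↦ X i j) :
      Set (EuclideanSpace ℝ (Fin n)))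
    have hset : bad J = {z | σ ^ 2 * ((20 + 4 * c) * #J * Real.log p) ≤
        ‖S.orthogonalProjectionOnto (WithLp.toLp 2 z)‖ ^ 2} := by
      ext z
      rw [Set.mem_ofPred_eq, Set.mem_ofPred_eq,
        norm_orthogonalProjectionOnto_span_columns_sq X J z (P J z) (hP J z).1 (hP J z).2]
      ring_nf
    have hrank : Module.finrank ℝ S ≤ #J :=
      (finrank_span_finset_le_card _).trans Finset.card_image_le
    rw [hset]
    refine (pi_gaussianReal_real_le_norm_orthogonalProjectionOnto_sq hσ S _).trans ?_
    rw [mul_pow, mul_comm, Real.rpow_def_of_pos hp0, ← Real.exp_nat_mul]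
    refine mul_le_mul (pow_le_pow_right₀ (Real.one_le_sqrt.2 one_le_two) hrank)
      (Real.exp_le_exp.2 (le_of_eq (by ring))) (by positivity) (by positivity)
  set good : Set (Fin n → ℝ) := {z | ∀ J : Finset (Fin p),
    ∑ i, (P J z i)^2 ≤ (20 + 4 * c) * σ^2 * (J.card : ℝ) * Real.log p}
  have hcover : Set.univ ⊆ good ∪ ⋃ J ∈ Finset.univ.filter Finset.Nonempty, bad J := by
    intro z _
    by_contra h
    simp only [Set.mem_union, not_or, Set.mem_iUnion, not_exists] at h
    refine h.1 fun J ↦ ?_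
    rcases J.eq_empty_or_nonempty with rfl | hJ
    · obtain ⟨cf, hcf, hPz⟩ := (hP ∅ z).1
      have hcf0 : cf = 0 := funext fun j ↦ hcf j (Finset.notMem_empty j)
      simp [hPz, hcf0]
    · exact (not_le.1 (h.2 J (by simpa using hJ))).le
  have hone : 1 ≤ μ.real good + (p : ℝ) ^ (-c) :=
    calc 1 = μ.real Set.univ := probReal_univ.symm
      _ ≤ μ.real (good ∪ ⋃ J ∈ Finset.univ.filter Finset.Nonempty, bad J) :=
        measureReal_mono hcover
      _ ≤ μ.real good + μ.real (⋃ J ∈ Finset.univ.filter Finset.Nonempty, bad J) :=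
        measureReal_union_le _ _
      _ ≤ μ.real good + ∑ J : Finset (Fin p) with J.Nonempty, μ.real (bad J) := by
        gcongr
        exact measureReal_biUnion_finset_le _ _
      _ ≤ μ.real good + ∑ J : Finset (Fin p) with J.Nonempty,
          (√2 * (p : ℝ) ^ (-(5 + c))) ^ #J := by
        gcongr with J _
        exact hbad J
      _ ≤ μ.real good + (p : ℝ) ^ (-c) := by
        gcongr
        exact sum_nonempty_sqrt_two_mul_rpow_le hp2 hc
  rw [← ofReal_measureReal (μ := μ) (s := good)]
  exact ENNReal.ofReal_le_ofReal (by linarith)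
end
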